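/- arXiv:2007.02636 — 4 statements merged into one kernel-verified Lean document; each statement's English description precedes it below -/
import Mathlib

section
/- Let G be a finite group and F an arbitrary field of characteristic 2. Then the Jacobson radical of the group algebra FG has odd codimension in FG, i.e. dim_F(FG) − dim_F(rad(FG)) is odd. -/
open Module

section Defs
variable {F : Type} [Field F] {G : Type} [Group G]
variable {V W : Type} [AddCommGroup V] [Module F V] [AddCommGroup W] [Module F W]

def IsSubrep (ρ : Representation F G V) (U : Submodule F V) : Prop :=
  ∀ (g : G), ∀ v ∈ U, ρ g v ∈ U

def IsIrred (ρ : Representation F G V) : Prop :=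
  Nontrivial V ∧ ∀ U : Submodule F V, IsSubrep ρ U → U = ⊥ ∨ U = ⊤

def RepIso (ρ : Representation F G V) (σ : Representation F G W) : Prop :=
  ∃ e : V ≃ₗ[F] W, ∀ (g : G) (v : V), e (ρ g v) = σ g (e v)

def IsSelfDual (ρ : Representation F G V) : Prop :=
  RepIso ρ ρ.dual

def IsTrivialRep (ρ : Representation F G V) : Prop := ∀ (g : G) (v : V), ρ g v = v

def EquivHom (σ : Representation F G W) (ρ : Representation F G V) :
    Submodule F (W →ₗ[F] V) where
  carrier := {f | ∀ (g : G) (w : W), f (σ g w) = ρ g (f w)}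
  add_mem' := by
    intro f f' hf hf' g w
    simp [LinearMap.add_apply, hf g w, hf' g w]
  zero_mem' := by intro g w; simp
  smul_mem' := by
    intro c f hf g w
    simp [LinearMap.smul_apply, hf g w]

noncomputable def repMult (σ : Representation F G W) (ρ : Representation F G V) : ℕ :=
  Module.finrank F (EquivHom σ ρ)

def BilinInvariant (ρ : Representation F G V) (B : V →ₗ[F] V →ₗ[F] F) : Prop :=
  ∀ (g : G) (v w : V), B (ρ g v) (ρ g w) = B v w

def Nondeg (B : V →ₗ[F] V →ₗ[F] F) : Prop := ∀ v : V, (∀ w : V, B v w = 0) → v = 0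

def IsAltForm (B : V →ₗ[F] V →ₗ[F] F) : Prop := ∀ v : V, B v v = 0

def PolarizesTo (Q : V → F) (B : V →ₗ[F] V →ₗ[F] F) : Prop :=
  (∀ (a : F) (v : V), Q (a • v) = a ^ 2 * Q v) ∧
    ∀ v w : V, Q (v + w) = Q v + B v w + Q w

def QuadInvariant (ρ : Representation F G V) (Q : V → F) : Prop :=
  ∀ (g : G) (v : V), Q (ρ g v) = Q v

def HasQuadType (ρ : Representation F G V) : Prop :=
  ∃ (Q : V → F) (B : V →ₗ[F] V →ₗ[F] F),
    PolarizesTo Q B ∧ QuadInvariant ρ Q ∧ Nondeg B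

def IsSplitting (F G : Type) [Field F] [Group G] : Prop :=
  ∀ (V : Type) [AddCommGroup V] [Module F V] (ρ : Representation F G V),
    FiniteDimensional F V → IsIrred ρ →
      ∀ f ∈ EquivHom ρ ρ, ∃ c : F, f = c • (LinearMap.id : V →ₗ[F] V)

structure RepOn (F G : Type) [Field F] [Group G] where
  carrier : Type
  [ag : AddCommGroup carrier]
  [md : Module F carrier]
  rep : Representation F G carrier

attribute [instance] RepOn.ag RepOn.md

end Defs

/-- A space carrying a nondegenerate alternating form has even dimension: a maximal totally
isotropic subspace is its own orthogonal complement. -/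
theorem even_finrank_of_isAlt {F V : Type*} [Field F] [AddCommGroup V] [Module F V]
    [FiniteDimensional F V] (B : LinearMap.BilinForm F V) (halt : B.IsAlt)
    (hB : B.Nondegenerate) : Even (finrank F V) := by
  obtain ⟨L, hL⟩ : ∃ L, Maximal (fun L : Submodule F V ↦ L ≤ B.orthogonal L) L :=
    exists_maximal_of_wellFoundedGT (fun L : Submodule F V ↦ L ≤ B.orthogonal L)
      ⟨⊥, bot_le⟩
  have hself : B.orthogonal L = L := by
    refine le_antisymm (fun x hx ↦ ?_) hL.prop
    have hiso : L ⊔ F ∙ x ≤ B.orthogonal (L ⊔ F ∙ x) := by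
      intro a ha b hb
      obtain ⟨l, hl, y, hy, rfl⟩ := Submodule.mem_sup.mp ha
      obtain ⟨l', hl', y', hy', rfl⟩ := Submodule.mem_sup.mp hb
      obtain ⟨c, rfl⟩ := Submodule.mem_span_singleton.mp hy
      obtain ⟨c', rfl⟩ := Submodule.mem_span_singleton.mp hy'
      have h₁ : B l' l = 0 := hL.prop hl l' hl'
      have h₂ : B l' x = 0 := hx l' hl'
      have h₃ : B x l = 0 := halt.isRefl _ _ (hx l hl)
      have h₄ : B x x = 0 := halt x
      simp [h₁, h₂, h₃, h₄]
    exact hL.le_of_ge hiso le_sup_left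
      (Submodule.mem_sup_right (Submodule.mem_span_singleton_self x))
  have h := LinearMap.BilinForm.finrank_orthogonal hB L
  rw [hself] at h
  have hle := Submodule.finrank_le L
  exact ⟨finrank F L, by omega⟩

section IsotypicComponents

variable {S : Type*} [Ring S]

theorem isTwoSided_of_mem_isotypicComponents {c : Ideal S} (hc : c ∈ isotypicComponents S S) :
    c.IsTwoSided :=
  isFullyInvariant_iff_isTwoSided.mp (.of_mem_isotypicComponents hc)

variable [IsSemisimpleRing S]

/-- A left ideal of a semisimple ring has a right identity. -/
theorem exists_right_identity_of_isSemisimpleRing (I : Ideal S) :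
    ∃ e ∈ I, ∀ x ∈ I, x * e = x := by
  obtain ⟨I', h⟩ := exists_isCompl I
  obtain ⟨e, he, e', he', hee⟩ :=
    Submodule.mem_sup.mp (h.sup_eq_top.ge (Submodule.mem_top (x := (1 : S))))
  refine ⟨e, he, fun x hx ↦ ?_⟩
  have hx' : x * e + x * e' = x := by rw [← mul_add, hee, mul_one]
  have h₀ : x * e' = 0 := by
    refine Submodule.disjoint_def.mp h.disjoint _ ?_ (I'.mul_mem_left x he')
    rw [eq_sub_of_add_eq' hx']
    exact I.sub_mem hx (I.mul_mem_left x he)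
  rwa [h₀, add_zero] at hx'

/-- The isotypic components of a semisimple ring are its minimal two-sided ideals. -/
theorem mem_isotypicComponents_iff_minimal {c : Ideal S} :
    c ∈ isotypicComponents S S ↔
      c.IsTwoSided ∧ c ≠ ⊥ ∧ ∀ I : Ideal S, I.IsTwoSided → I ≤ c → I = ⊥ ∨ I = c := by
  constructor
  · refine fun hc ↦ ⟨isTwoSided_of_mem_isotypicComponents hc, (bot_lt_isotypicComponents hc).ne',
      fun I hI hle ↦ ?_⟩
    refine (IsSemisimpleModule.eq_bot_or_exists_simple_le I).imp_right fun ⟨V, hV, _⟩ ↦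
      le_antisymm hle ?_
    rw [eq_isotypicComponent_of_le hc (hV.trans hle)]
    exact isFullyInvariant_iff_le_imp_isotypicComponent_le.mp
      (isFullyInvariant_iff_isTwoSided.mpr hI) V hV
  · rintro ⟨hts, hne, hmin⟩
    obtain ⟨V, hV, hsimple⟩ := (IsSemisimpleModule.eq_bot_or_exists_simple_le c).resolve_left hne
    have hle := isFullyInvariant_iff_le_imp_isotypicComponent_le.mp
      (isFullyInvariant_iff_isTwoSided.mpr hts) V hV
    exact ⟨V, hsimple, ((hmin _ (isFullyInvariant_iff_isTwoSided.mp
      (.isotypicComponent S S V)) hle).resolve_left (bot_lt_isotypicComponent V).ne').symm⟩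

theorem finrank_eq_sum_isotypicComponents (F : Type*) [Field F] [Algebra F S] [Module.Finite F S]
    [Fintype (isotypicComponents S S)] :
    finrank F S = ∑ c : isotypicComponents S S, finrank F c.1 := by
  classical
  have e := (((sSupIndep_iff _).mp (sSupIndep_isotypicComponents S S)).linearEquiv
    ((sSup_eq_iSup' _).symm.trans (sSup_isotypicComponents S S))).symm.trans
      (DFinsupp.linearEquivFunOnFintype (R := S))
  have (c : isotypicComponents S S) : Module.Finite F c.1 :=
    .of_injective (c.1.subtype.restrictScalars F) c.1.subtype_injective
  rw [(e.restrictScalars F).finrank_eq, finrank_pi_fintype]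

/-- The dimension of an isotypic component is a multiple of the dimension of a simple left ideal
contained in it. -/
theorem exists_simple_le_finrank_dvd (F : Type*) [Field F] [Algebra F S] [Module.Finite F S]
    {c : Ideal S} (hc : c ∈ isotypicComponents S S) :
    ∃ V ≤ c, IsSimpleModule S V ∧ finrank F V ∣ finrank F c := by
  have : IsNoetherianRing S := isNoetherian_of_tower F inferInstance
  have : Nontrivial c := Submodule.nontrivial_iff_ne_bot.mpr (bot_lt_isotypicComponents hc).ne'
  obtain ⟨n, -, V, hV, hs, ⟨e⟩⟩ := (IsIsotypic.isotypicComponents hc).submodule_linearEquiv_fun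
  have : Module.Finite F V :=
    .of_injective (V.subtype.restrictScalars F) V.subtype_injective
  refine ⟨V, hV, hs, n, ?_⟩
  rw [(e.restrictScalars F).finrank_eq, finrank_pi_fintype]
  simp [mul_comm]

end IsotypicComponents

section AntiInvolution

variable {F S : Type*} [Field F] [Ring S] [Algebra F S] {σ : S →ₗ[F] S}

/-- The preimage of a two-sided ideal under an anti-endomorphism. -/
def antiComap (σ : S →ₗ[F] S) (hmul : ∀ a b, σ (a * b) = σ b * σ a) (I : Ideal S)
    [I.IsTwoSided] : Ideal S where
  carrier := {x | σ x ∈ I}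
  add_mem' {a b} ha hb := by
    simpa using I.add_mem ha hb
  zero_mem' := by simp
  smul_mem' a b hb := by
    simpa [hmul] using I.mul_mem_right (σ a) hb

theorem mem_antiComap {hmul : ∀ a b, σ (a * b) = σ b * σ a} {I : Ideal S} [I.IsTwoSided] {x : S} :
    x ∈ antiComap σ hmul I ↔ σ x ∈ I := Iff.rfl

instance isTwoSided_antiComap {hmul : ∀ a b, σ (a * b) = σ b * σ a} {I : Ideal S} [I.IsTwoSided] :
    (antiComap σ hmul I).IsTwoSided :=
  ⟨fun b ha ↦ by
    rw [mem_antiComap, hmul]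
    exact I.mul_mem_left _ ha⟩

theorem antiComap_antiComap {hmul : ∀ a b, σ (a * b) = σ b * σ a} (hinv : ∀ a, σ (σ a) = a)
    {I : Ideal S} [I.IsTwoSided] :
    antiComap σ hmul (antiComap σ hmul I) = I := by
  ext x
  simp [mem_antiComap, hinv]

theorem finrank_antiComap {hmul : ∀ a b, σ (a * b) = σ b * σ a} (hinv : ∀ a, σ (σ a) = a)
    {I : Ideal S} [I.IsTwoSided] : finrank F (antiComap σ hmul I) = finrank F I :=
  LinearEquiv.finrank_eq <| LinearEquiv.ofLinearMap
    (σ.restrict (p := (antiComap σ hmul I).restrictScalars F) (q := I.restrictScalars F)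
      fun _ hx ↦ hx)
    (σ.restrict (p := I.restrictScalars F) (q := (antiComap σ hmul I).restrictScalars F)
      fun x hx ↦ by
        have : σ (σ x) ∈ I := by rwa [hinv]
        exact this)
    (LinearMap.ext fun x ↦ Subtype.ext (hinv x)) (LinearMap.ext fun x ↦ Subtype.ext (hinv x))

theorem antiComap_mem_isotypicComponents [IsSemisimpleRing S]
    {hmul : ∀ a b, σ (a * b) = σ b * σ a} (hinv : ∀ a, σ (σ a) = a) {c : Ideal S} [c.IsTwoSided]
    (hc : c ∈ isotypicComponents S S) : antiComap σ hmul c ∈ isotypicComponents S S := by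
  rw [mem_isotypicComponents_iff_minimal] at hc ⊢
  obtain ⟨-, hne, hmin⟩ := hc
  refine ⟨isTwoSided_antiComap, fun h ↦ hne ?_, fun I hI hle ↦ ?_⟩
  · rw [eq_bot_iff]
    intro x hx
    have hx' : σ x ∈ antiComap σ hmul c := by rwa [mem_antiComap, hinv]
    rw [h, Ideal.mem_bot] at hx'
    rw [Ideal.mem_bot, ← hinv x, hx', map_zero]
  · have hle' : antiComap σ hmul I ≤ c := fun x hx ↦ by simpa [mem_antiComap, hinv] using hle hx
    refine (hmin _ isTwoSided_antiComap hle').imp (fun h ↦ eq_bot_iff.mpr fun x hx ↦ ?_) fun h ↦ ?_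
    · have hx' : σ x ∈ antiComap σ hmul I := by rwa [mem_antiComap, hinv]
      rw [h, Ideal.mem_bot] at hx'
      rw [Ideal.mem_bot, ← hinv x, hx', map_zero]
    · subst h
      exact (antiComap_antiComap hinv).symm

/-- In an isotypic component stable under an anti-involution, a nonzero left ideal `V` is not
isotropic, in the sense that `σ V * V ≠ 0`. -/
theorem exists_anti_mul_ne_zero [IsSemisimpleRing S] (hinv : ∀ a, σ (σ a) = a)
    {c : Ideal S} (hc : c ∈ isotypicComponents S S) (hσ : ∀ x ∈ c, σ x ∈ c) {V : Ideal S}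
    (hV : V ≤ c) (hne : V ≠ ⊥) : ∃ x ∈ V, ∃ y ∈ V, σ x * y ≠ 0 := by
  by_contra! h
  obtain ⟨hts, -, hmin⟩ := mem_isotypicComponents_iff_minimal.mp hc
  obtain ⟨x, hx, hx0⟩ := Submodule.exists_mem_ne_zero_of_ne_bot hne
  have hann {s : S} : s ∈ Module.annihilator S V ↔ ∀ y ∈ V, s * y = 0 := by
    simp [Module.mem_annihilator, Subtype.ext_iff]
  have hcV : c ≤ Module.annihilator S V := by
    refine inf_eq_right.mp ((hmin (Module.annihilator S V ⊓ c) ⟨fun b ha ↦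
      ⟨Ideal.mul_mem_right b _ ha.1, Ideal.mul_mem_right b _ ha.2⟩⟩ inf_le_right).resolve_left
        fun h0 ↦ hx0 ?_)
    have : σ x ∈ Module.annihilator S V ⊓ c := ⟨hann.mpr (h x hx), hσ x (hV hx)⟩
    rw [h0, Ideal.mem_bot] at this
    rw [← hinv x, this, map_zero]
  obtain ⟨e, he, hxe⟩ := exists_right_identity_of_isSemisimpleRing V
  exact hx0 ((hxe x hx).symm.trans (hann.mp (hcV (hV hx)) e he))

/-- A nonzero symmetric form `(a, b) ↦ ℓ (σ a * b)` on a left ideal `V` with `σ V * V ≠ 0`. -/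
theorem exists_symmetric_functional [CharP F 2] (hmul : ∀ a b, σ (a * b) = σ b * σ a)
    (hinv : ∀ a, σ (σ a) = a) {V : Ideal S} (hV : ∃ x ∈ V, ∃ y ∈ V, σ x * y ≠ 0) :
    ∃ ℓ : S →ₗ[F] F, (∀ a ∈ V, ∀ b ∈ V, ℓ (σ a * b) = ℓ (σ b * a)) ∧
      ∃ a ∈ V, ∃ b ∈ V, ℓ (σ a * b) ≠ 0 := by
  by_cases h : ∀ a ∈ V, ∀ b ∈ V, σ a * b = σ b * a
  · obtain ⟨x, hx, y, hy, hxy⟩ := hV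
    obtain ⟨ℓ, hℓ⟩ := not_forall.mp (mt (forall_dual_apply_eq_zero_iff F (σ x * y)).mp hxy)
    exact ⟨ℓ, fun a ha b hb ↦ by rw [h a ha b hb], x, hx, y, hy, hℓ⟩
  · push Not at h
    obtain ⟨x, hx, y, hy, hxy⟩ := h
    obtain ⟨ℓ, hℓ⟩ := not_forall.mp
      (mt (forall_dual_apply_eq_zero_iff F (σ x * y - σ y * x)).mp (sub_ne_zero.mpr hxy))
    refine ⟨ℓ + ℓ ∘ₗ σ, fun a _ b _ ↦ ?_, x, hx, y, hy, ?_⟩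
    · simp [hmul, hinv, add_comm]
    · rw [map_sub, CharTwo.sub_eq_add] at hℓ
      simpa [hmul, hinv] using hℓ

/-- Fong's lemma: let `V` be a simple left ideal with `σ V * V ≠ 0` in an algebra of
characteristic two spanned by `σ`-unitary elements of augmentation one. If the action on `V` is
not through the augmentation, then `V` carries a nondegenerate alternating form, whence its
dimension is even. -/
theorem even_finrank_or_smul_eq_augmentation [CharP F 2] [Module.Finite F S]
    (hmul : ∀ a b, σ (a * b) = σ b * σ a) (hinv : ∀ a, σ (σ a) = a) {ε : S →ₐ[F] F}
    (hspan : Submodule.span F {u : S | σ u * u = 1 ∧ ε u = 1} = ⊤)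
    {V : Ideal S} [hsimple : IsSimpleModule S V] (hV : ∃ x ∈ V, ∃ y ∈ V, σ x * y ≠ 0) :
    Even (finrank F V) ∨ ∀ s, ∀ v ∈ V, s * v = ε s • v := by
  have hatom : ∀ W ≤ V, W = ⊥ ∨ W = V := fun W hW ↦
    (isSimpleModule_iff_isAtom.mp hsimple).le_iff.mp hW
  obtain ⟨ℓ, hsymm, x, hx, y, hy, hxy⟩ := exists_symmetric_functional hmul hinv hV
  by_cases halt : ∀ v ∈ V, ℓ (σ v * v) = 0
  · left
    let R : Ideal S :=
      { carrier := {b | b ∈ V ∧ ∀ a ∈ V, ℓ (σ a * b) = 0}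
        add_mem' := fun hb hb' ↦ ⟨V.add_mem hb.1 hb'.1, fun a ha ↦ by
          rw [mul_add, map_add, hb.2 a ha, hb'.2 a ha, add_zero]⟩
        zero_mem' := by simp
        smul_mem' := fun s b hb ↦ ⟨V.mul_mem_left s hb.1, fun a ha ↦ by
          simpa [hmul, hinv, mul_assoc] using hb.2 (σ s * a) (V.mul_mem_left _ ha)⟩ }
    have hR : R = ⊥ := (hatom R fun _ hb ↦ hb.1).resolve_right fun h ↦ by
      have hyR : y ∈ R := h ▸ hy
      exact hxy (hyR.2 x hx)
    let B : LinearMap.BilinForm F V := LinearMap.mk₂ F (fun a b ↦ ℓ (σ a * b))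
      (by simp [add_mul]) (by simp) (by simp [mul_add]) (by simp)
    have hB : B.IsAlt := fun v ↦ halt v v.2
    have : Module.Finite F V :=
      .of_injective (V.subtype.restrictScalars F) V.subtype_injective
    refine even_finrank_of_isAlt B hB
      (hB.isRefl.nondegenerate_iff_separatingRight.mpr fun b hb ↦ ?_)
    have hbR : (b : S) ∈ R := ⟨b.2, fun a ha ↦ hb ⟨a, ha⟩⟩
    rw [hR, Ideal.mem_bot] at hbR
    exact Subtype.ext hbR
  · right
    have hadd : ∀ a ∈ V, ∀ b ∈ V,
        ℓ (σ (a + b) * (a + b)) = ℓ (σ a * a) + ℓ (σ b * b) := fun a ha b hb ↦ by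
      have h2 := CharTwo.add_self_eq_zero (ℓ (σ b * a))
      simp only [map_add, add_mul, mul_add, hsymm a ha b hb]
      linear_combination h2
    have hunit : ∀ u v, σ u * u = 1 → ℓ (σ (u * v) * (u * v)) = ℓ (σ v * v) := fun u v hu ↦ by
      rw [hmul, mul_assoc, ← mul_assoc (σ u), hu, one_mul]
    have hsmul : ∀ s, ∀ b ∈ V, ℓ (σ b * b) = 0 → ℓ (σ (s * b) * (s * b)) = 0 := by
      intro s b hb hb0
      induction (hspan ▸ Submodule.mem_top : s ∈ Submodule.span F _) using
        Submodule.span_induction with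
      | mem u hu => rw [hunit u b hu.1, hb0]
      | zero => simp
      | add s t _ _ hs ht =>
        rw [add_mul, hadd _ (V.mul_mem_left s hb) _ (V.mul_mem_left t hb), hs, ht, add_zero]
      | smul k s _ hs => simp [hs]
    let N : Ideal S :=
      { carrier := {b | b ∈ V ∧ ℓ (σ b * b) = 0}
        add_mem' := fun {a b} ha hb ↦ ⟨V.add_mem ha.1 hb.1, by
          rw [hadd a ha.1 b hb.1, ha.2, hb.2, add_zero]⟩
        zero_mem' := by simp
        smul_mem' := fun s b hb ↦ ⟨V.mul_mem_left s hb.1, hsmul s b hb.1 hb.2⟩ }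
    have hN : N = ⊥ := (hatom N fun _ hb ↦ hb.1).resolve_right fun h ↦
      halt fun v hv ↦ (h ▸ hv : v ∈ N).2
    intro s v hv
    induction (hspan ▸ Submodule.mem_top : s ∈ Submodule.span F _) using
      Submodule.span_induction with
    | mem u hu =>
      have huv : u * v + v ∈ N := ⟨V.add_mem (V.mul_mem_left u hv) hv, by
        rw [hadd _ (V.mul_mem_left u hv) v hv, hunit u v hu.1, CharTwo.add_self_eq_zero]⟩
      have hvv : v + v = 0 := by rw [← two_smul F, CharTwo.two_eq_zero, zero_smul]
      rw [hN, Ideal.mem_bot] at huv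
      rw [hu.2, one_smul, eq_neg_of_add_eq_zero_left huv]
      exact (eq_neg_of_add_eq_zero_left hvv).symm
    | zero => simp
    | add s t _ _ hs ht => rw [add_mul, hs, ht, map_add, add_smul]
    | smul k s _ hs => rw [smul_mul_assoc, hs, map_smul, smul_eq_mul, mul_smul]

theorem even_finrank_of_augmentation_eq_zero [IsSemisimpleRing S] [CharP F 2] [Module.Finite F S]
    (hmul : ∀ a b, σ (a * b) = σ b * σ a) (hinv : ∀ a, σ (σ a) = a) {ε : S →ₐ[F] F}
    (hspan : Submodule.span F {u : S | σ u * u = 1 ∧ ε u = 1} = ⊤)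
    {c : Ideal S} (hc : c ∈ isotypicComponents S S) (hσ : ∀ x ∈ c, σ x ∈ c)
    (hε : ∀ x ∈ c, ε x = 0) : Even (finrank F c) := by
  obtain ⟨V, hV, hsimple, hdvd⟩ := exists_simple_le_finrank_dvd F hc
  have hne : V ≠ ⊥ := (isSimpleModule_iff_isAtom.mp hsimple).1
  refine ((even_finrank_or_smul_eq_augmentation hmul hinv hspan
    (exists_anti_mul_ne_zero hinv hc hσ hV hne)).resolve_right fun h ↦ ?_).trans_dvd hdvd
  obtain ⟨e, he, hxe⟩ := exists_right_identity_of_isSemisimpleRing V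
  obtain ⟨x, hx, hx0⟩ := Submodule.exists_mem_ne_zero_of_ne_bot hne
  exact hx0 (by rw [← hxe x hx, h x e he, hε x (hV hx), zero_smul])

theorem finrank_eq_one_of_augmentation_ne_zero [IsSemisimpleRing S] [Module.Finite F S]
    {ε : S →ₐ[F] F} {c : Ideal S} (hc : c ∈ isotypicComponents S S) (hε : ∃ x ∈ c, ε x ≠ 0) :
    finrank F c = 1 := by
  obtain ⟨x, hx, hx0⟩ := hε
  obtain ⟨hts, -, hmin⟩ := mem_isotypicComponents_iff_minimal.mp hc
  have hker : RingHom.ker ε ⊓ c = ⊥ := (hmin (RingHom.ker ε ⊓ c) ⟨fun b ha ↦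
    ⟨Ideal.mul_mem_right b _ ha.1, Ideal.mul_mem_right b _ ha.2⟩⟩ inf_le_right).resolve_right
      fun h ↦ hx0 (inf_eq_right.mp h hx)
  let f : c →ₗ[F] F := ε.toLinearMap ∘ₗ c.subtype.restrictScalars F
  have hf : Function.Injective f := (injective_iff_map_eq_zero f).mpr fun a ha ↦ by
    have : (a : S) ∈ RingHom.ker ε ⊓ c := ⟨ha, a.2⟩
    rw [hker, Ideal.mem_bot] at this
    exact Subtype.ext this
  have hf' : Function.Surjective f :=
    LinearMap.surjective fun h ↦ hx0 (LinearMap.congr_fun h ⟨x, hx⟩)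
  rw [(LinearEquiv.ofBijective f ⟨hf, hf'⟩).finrank_eq, finrank_self]

/-- Exactly one isotypic component is not killed by the augmentation. -/
theorem existsUnique_augmentation_ne_zero [IsSemisimpleRing S] (ε : S →ₐ[F] F) :
    ∃! c : isotypicComponents S S, ∃ x ∈ c.1, ε x ≠ 0 := by
  refine existsUnique_of_exists_of_unique ?_ ?_
  · by_contra! h
    have hle : (⊤ : Ideal S) ≤ RingHom.ker ε := by
      rw [← sSup_isotypicComponents S S]
      exact sSup_le fun c hc x hx ↦ h ⟨c, hc⟩ x hx
    exact one_ne_zero (α := F) (by simpa using (hle trivial : (1 : S) ∈ RingHom.ker ε))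
  · rintro ⟨c, hc⟩ ⟨c', hc'⟩ ⟨x, hx, hx0⟩ ⟨y, hy, hy0⟩
    obtain ⟨hts, -, hmin⟩ := mem_isotypicComponents_iff_minimal.mp hc
    obtain ⟨hts', -, hmin'⟩ := mem_isotypicComponents_iff_minimal.mp hc'
    have hinf : Ideal.IsTwoSided (c ⊓ c') := ⟨fun b ha ↦
      ⟨Ideal.mul_mem_right b _ ha.1, Ideal.mul_mem_right b _ ha.2⟩⟩
    have hne : c ⊓ c' ≠ ⊥ := fun h ↦ by
      have hxy : x * y ∈ c ⊓ c' := ⟨Ideal.mul_mem_right _ _ hx, Ideal.mul_mem_left c' x hy⟩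
      rw [h, Ideal.mem_bot] at hxy
      exact mul_ne_zero hx0 hy0 (by rw [← map_mul, hxy, map_zero])
    exact Subtype.ext <| ((hmin _ hinf inf_le_left).resolve_left hne).symm.trans
      ((hmin' _ hinf inf_le_right).resolve_left hne)

/-- A semisimple algebra of characteristic two with an anti-involution `σ`, spanned by `σ`-unitary
elements of augmentation one, has odd dimension. -/
theorem odd_finrank_of_antiInvolution [IsSemisimpleRing S] [CharP F 2] [Module.Finite F S]
    (hmul : ∀ a b, σ (a * b) = σ b * σ a) (hinv : ∀ a, σ (σ a) = a) {ε : S →ₐ[F] F}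
    (hspan : Submodule.span F {u : S | σ u * u = 1 ∧ ε u = 1} = ⊤) : Odd (finrank F S) := by
  classical
  have : IsNoetherianRing S := isNoetherian_of_tower F inferInstance
  have := Fintype.ofFinite (isotypicComponents S S)
  have hts (c : isotypicComponents S S) : Ideal.IsTwoSided c.1 :=
    isTwoSided_of_mem_isotypicComponents c.2
  have hεσ : ∀ x, ε (σ x) = ε x := fun x ↦ by
    have h : ε.toLinearMap ∘ₗ σ = ε.toLinearMap := LinearMap.ext_on hspan fun u hu ↦ by
      simpa [hu.2] using congrArg ε hu.1
    exact LinearMap.congr_fun h x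
  let τ (c : isotypicComponents S S) : isotypicComponents S S :=
    ⟨antiComap σ hmul c.1, antiComap_mem_isotypicComponents hinv c.2⟩
  have hττ (c) : τ (τ c) = c := Subtype.ext (antiComap_antiComap (hmul := hmul) hinv)
  obtain ⟨c₀, hc₀, huniq⟩ := existsUnique_augmentation_ne_zero ε
  have hτ₀ : τ c₀ = c₀ := huniq _ <| by
    obtain ⟨x, hx, hx0⟩ := hc₀
    exact ⟨σ x, show σ (σ x) ∈ c₀.1 by rwa [hinv], by rwa [hεσ]⟩
  rw [← ZMod.natCast_eq_one_iff_odd, finrank_eq_sum_isotypicComponents F,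
    ← Finset.add_sum_erase _ _ (Finset.mem_univ c₀),
    finrank_eq_one_of_augmentation_ne_zero c₀.2 hc₀]
  push_cast
  rw [add_eq_left]
  refine Finset.sum_involution (fun c _ ↦ τ c) (fun c _ ↦ ?_) (fun c hc h0 hfix ↦ h0 ?_)
    (fun c hc ↦ ?_) (fun c _ ↦ hττ c)
  · change _ + ((finrank F (antiComap σ hmul c.1) : ℕ) : ZMod 2) = 0
    rw [finrank_antiComap hinv, CharTwo.add_self_eq_zero]
  · rw [ZMod.natCast_eq_zero_iff_even]
    refine even_finrank_of_augmentation_eq_zero hmul hinv hspan c.2 (fun x hx ↦ ?_) fun x hx ↦ ?_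
    · have : x ∈ (τ c).1 := by rwa [hfix]
      exact this
    · by_contra hx0
      exact Finset.ne_of_mem_erase hc (huniq c ⟨x, hx, hx0⟩)
  · refine Finset.mem_erase.mpr ⟨fun h ↦ Finset.ne_of_mem_erase hc ?_, Finset.mem_univ _⟩
    exact (hττ c).symm.trans ((congrArg τ h).trans hτ₀)

end AntiInvolution

section GroupAlgebra

open MulOpposite

variable (F G : Type*) [Field F] [Group G]

/-- The anti-automorphism of the group algebra inverting the group elements. -/
noncomputable def groupAlgebraInv : MonoidAlgebra F G →ₐ[F] (MonoidAlgebra F G)ᵐᵒᵖ :=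
  MonoidAlgebra.lift F (MonoidAlgebra F G)ᵐᵒᵖ G
    { toFun := fun g ↦ op (MonoidAlgebra.of F G g⁻¹)
      map_one' := by simp [MonoidAlgebra.one_def]
      map_mul' := fun g h ↦ by rw [mul_inv_rev, map_mul, op_mul] }

variable {F G}

theorem groupAlgebraInv_of (g : G) :
    groupAlgebraInv F G (MonoidAlgebra.of F G g) = op (MonoidAlgebra.of F G g⁻¹) := by
  simp [groupAlgebraInv]

theorem span_range_of_eq_top : Submodule.span F (Set.range (MonoidAlgebra.of F G)) = ⊤ :=
  eq_top_iff.mpr fun x _ ↦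
    Submodule.span_mono (Set.image_subset_range _ _) (MonoidAlgebra.mem_span_support_coeff x)

theorem groupAlgebraInv_groupAlgebraInv (x : MonoidAlgebra F G) :
    (groupAlgebraInv F G (groupAlgebraInv F G x).unop).unop = x := by
  let f : MonoidAlgebra F G →ₗ[F] MonoidAlgebra F G :=
    (opLinearEquiv F).symm.toLinearMap ∘ₗ (groupAlgebraInv F G).toLinearMap
  have h : f ∘ₗ f = LinearMap.id := LinearMap.ext_on span_range_of_eq_top <| by
    rintro _ ⟨g, rfl⟩
    change (groupAlgebraInv F G (groupAlgebraInv F G (MonoidAlgebra.of F G g)).unop).unop = _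
    rw [groupAlgebraInv_of, unop_op, groupAlgebraInv_of, inv_inv, unop_op, LinearMap.id_apply]
  exact LinearMap.congr_fun h x

/-- In a left Artinian ring, an anti-automorphism preserves the Jacobson radical. -/
theorem unop_map_mem_jacobson {A : Type*} [Ring A] [IsArtinianRing A] (f : A →+* Aᵐᵒᵖ)
    (hf : ∀ x, (f (f x).unop).unop = x) {x : A} (hx : x ∈ Ring.jacobson A) :
    (f x).unop ∈ Ring.jacobson A := by
  rw [← Ideal.jacobson_bot, Ideal.mem_jacobson_iff]
  intro y
  obtain ⟨n, hn⟩ := IsSemiprimaryRing.isNilpotent (R := A)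
  have hnil : IsNilpotent (y * (f x).unop) := by
    have hmem : x * (f y).unop ∈ Ring.jacobson A := Ideal.mul_mem_right _ _ hx
    have hpow : (x * (f y).unop) ^ n = 0 := by
      have := Ideal.pow_mem_pow hmem n
      rwa [hn] at this
    refine ⟨n, ?_⟩
    have := congrArg (fun a ↦ (f a).unop) hpow
    simpa [hf] using this
  obtain ⟨u, hu⟩ := hnil.isUnit_add_one
  refine ⟨(↑u⁻¹ : A), ?_⟩
  rw [Ideal.mem_bot, mul_assoc, ← mul_add_one, ← hu, Units.inv_mul, sub_self]

end GroupAlgebra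

/-- in characteristic 2 the Jacobson radical of the group algebra FG has odd
codimension. -/
theorem stmt_2 {F : Type} [Field F] [CharP F 2] {G : Type} [Group G] [Fintype G] :
    Odd (Module.finrank F (MonoidAlgebra F G) -
      Module.finrank F
        ((Ideal.jacobson (⊥ : Ideal (MonoidAlgebra F G))).restrictScalars F)) := by
  have : IsArtinianRing (MonoidAlgebra F G) := isArtinian_of_tower F inferInstance
  rw [Ideal.jacobson_bot]
  let J := Ring.jacobson (MonoidAlgebra F G)
  let p : MonoidAlgebra F G →ₐ[F] MonoidAlgebra F G ⧸ J := Ideal.Quotient.mkₐ F J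
  have hp : Function.Surjective p := Ideal.Quotient.mk_surjective
  let τ : MonoidAlgebra F G ⧸ J →ₐ[F] (MonoidAlgebra F G ⧸ J)ᵐᵒᵖ :=
    Ideal.Quotient.liftₐ J ((AlgHom.op p).comp (groupAlgebraInv F G)) fun x hx ↦
      MulOpposite.unop_injective <| Ideal.Quotient.eq_zero_iff_mem.mpr <|
        unop_map_mem_jacobson (groupAlgebraInv F G).toRingHom groupAlgebraInv_groupAlgebraInv hx
  let aug : MonoidAlgebra F G →ₐ[F] F := MonoidAlgebra.lift F F G 1
  let ε : MonoidAlgebra F G ⧸ J →ₐ[F] F := Ideal.Quotient.liftₐ J aug fun x hx ↦ by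
    have : RingHomSurjective aug.toRingHom := ⟨fun a ↦ ⟨algebraMap F _ a, aug.commutes a⟩⟩
    have : aug x ∈ Ring.jacobson F := Ring.le_comap_jacobson aug.toRingHom hx
    rwa [IsSemisimpleRing.jacobson_eq_bot] at this
  let σ : MonoidAlgebra F G ⧸ J →ₗ[F] MonoidAlgebra F G ⧸ J :=
    (MulOpposite.opLinearEquiv F).symm.toLinearMap ∘ₗ τ.toLinearMap
  have hσ (x) : σ (p x) = p (groupAlgebraInv F G x).unop := rfl
  have hε (x) : ε (p x) = aug x := rfl
  have hspan : Submodule.span F {u | σ u * u = 1 ∧ ε u = 1} = ⊤ := by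
    rw [eq_top_iff, ← LinearMap.range_eq_top.mpr (show Function.Surjective p.toLinearMap from hp),
      LinearMap.range_eq_map, ← span_range_of_eq_top, Submodule.map_span, Submodule.span_le]
    rintro _ ⟨_, ⟨g, rfl⟩, rfl⟩
    refine Submodule.subset_span ⟨?_, ?_⟩
    · change σ (p _) * p _ = 1
      rw [hσ, groupAlgebraInv_of, MulOpposite.unop_op, ← map_mul, ← map_mul, inv_mul_cancel,
        map_one, map_one]
    · change ε (p _) = 1
      rw [hε]
      simp [aug]
  have hodd : Odd (finrank F (MonoidAlgebra F G ⧸ J)) :=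
    odd_finrank_of_antiInvolution (σ := σ) (ε := ε)
      (fun a b ↦ congrArg MulOpposite.unop (map_mul τ a b))
      (fun a ↦ by
        obtain ⟨x, rfl⟩ := hp a
        rw [hσ, hσ, groupAlgebraInv_groupAlgebraInv])
      hspan
  have := Submodule.finrank_quotient_add_finrank (J.restrictScalars F)
  rw [← this, Nat.add_sub_cancel]
  exact hodd
end

section
/- Let G be a finite group, N a normal subgroup of odd index in G, F a perfect splitting field of characteristic 2, and W a G-invariant self-dual irreducible FN-module. Then there is exactly one self-dual irreducible FG-module lying over W (namely the unique self-dual extension of W). -/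
open Module

section Forms

variable {F : Type} [Field F] {G : Type} [Group G]
variable {V W : Type} [AddCommGroup V] [Module F V] [AddCommGroup W] [Module F W]

theorem Nondeg.bijective [FiniteDimensional F V] {B : V →ₗ[F] V →ₗ[F] F} (hB : Nondeg B) :
    Function.Bijective B := by
  have hinj : Function.Injective B := by
    rw [injective_iff_map_eq_zero]
    exact fun v hv => hB v fun w => by rw [hv, LinearMap.zero_apply]
  exact ⟨hinj, (LinearMap.injective_iff_surjective_of_finrank_eq_finrank
    (Subspace.dual_finrank_eq (K := F) (V := V)).symm).1 hinj⟩

theorem Nondeg.flip [FiniteDimensional F V] {B : V →ₗ[F] V →ₗ[F] F} (hB : Nondeg B) :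
    Nondeg B.flip := by
  intro v hv
  rw [← Module.forall_dual_apply_eq_zero_iff F v]
  intro φ
  obtain ⟨w, rfl⟩ := hB.bijective.2 φ
  exact hv w

theorem Nondeg.injective_of_preserves {B : V →ₗ[F] V →ₗ[F] F} (hB : Nondeg B) {R : V →ₗ[F] V}
    (hR : ∀ v w, B (R v) (R w) = B v w) : Function.Injective R := by
  rw [injective_iff_map_eq_zero]
  intro v hv
  refine hB v fun w => ?_
  rw [← hR, hv, map_zero, LinearMap.zero_apply]

theorem IsSelfDual.exists_form {ρ : Representation F G V} (h : IsSelfDual ρ) :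
    ∃ B : V →ₗ[F] V →ₗ[F] F, BilinInvariant ρ B ∧ Nondeg B := by
  obtain ⟨e, he⟩ := h
  refine ⟨e.toLinearMap, fun g v w => ?_, fun v hv => ?_⟩
  · simp [he, Module.Dual.transpose_apply, ← Module.End.mul_apply, ← map_mul]
  · exact e.map_eq_zero_iff.1 (LinearMap.ext hv)

theorem isSelfDual_of_form [FiniteDimensional F V] {ρ : Representation F G V}
    {B : V →ₗ[F] V →ₗ[F] F} (hB : BilinInvariant ρ B) (hnd : Nondeg B) : IsSelfDual ρ := by
  refine ⟨LinearEquiv.ofBijective B hnd.bijective, fun g v => ?_⟩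
  refine LinearMap.ext fun w => ?_
  have := hB g v (ρ g⁻¹ w)
  rw [← Module.End.mul_apply (ρ g), ← map_mul, mul_inv_cancel, map_one] at this
  simpa [Module.Dual.transpose_apply] using this

theorem exists_eq_mul_of_bilinInvariant [FiniteDimensional F V] {ρ : Representation F G V}
    (hend : ∀ f ∈ EquivHom ρ ρ, ∃ c : F, f = c • (LinearMap.id : V →ₗ[F] V))
    {B C : V →ₗ[F] V →ₗ[F] F} (hB : BilinInvariant ρ B) (hnd : Nondeg B)
    (hC : BilinInvariant ρ C) : ∃ c : F, ∀ v w, C v w = c * B v w := by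
  let e := LinearEquiv.ofBijective B hnd.bijective
  have he : ∀ v w, B (e.symm (C v)) w = C v w := fun v w =>
    congrArg (fun φ : Dual F V => φ w) (e.apply_symm_apply (C v))
  obtain ⟨c, hc⟩ := hend (e.symm.toLinearMap ∘ₗ C) fun g v => by
    refine hnd.bijective.1 (LinearMap.ext fun w => ?_)
    have hw : w = ρ g (ρ g⁻¹ w) := by
      rw [← Module.End.mul_apply, ← map_mul, mul_inv_cancel, map_one, Module.End.one_apply]
    simp only [LinearMap.comp_apply, LinearEquiv.coe_coe]
    rw [he, hw, hB, he, hC]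
  refine ⟨c, fun v w => ?_⟩
  have := LinearMap.congr_fun hc v
  simp only [LinearMap.comp_apply, LinearEquiv.coe_coe, LinearMap.smul_apply,
    LinearMap.id_apply] at this
  rw [← he, this, map_smul, LinearMap.smul_apply, smul_eq_mul]

/-- An absolutely irreducible self-dual representation of a group of odd order, in coprime
characteristic, has a nonzero invariant vector. -/
theorem exists_ne_zero_forall_apply_eq_of_odd_card [Finite G] (hodd : Odd (Nat.card G))
    (hcard : (Nat.card G : F) ≠ 0) [FiniteDimensional F V] [Nontrivial V]
    {ρ : Representation F G V}
    (hend : ∀ f ∈ EquivHom ρ ρ, ∃ c : F, f = c • (LinearMap.id : V →ₗ[F] V))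
    {B : V →ₗ[F] V →ₗ[F] F} (hB : BilinInvariant ρ B) (hnd : Nondeg B) :
    ∃ v : V, v ≠ 0 ∧ ∀ g, ρ g v = v := by
  classical
  have := Fintype.ofFinite G
  by_contra! hno
  have hsum : ∀ v, ∑ g, ρ g v = 0 := by
    intro v
    by_contra hv
    obtain ⟨g, hg⟩ := hno _ hv
    refine hg ?_
    rw [map_sum]
    exact Fintype.sum_equiv (Equiv.mulLeft g) _ _ fun k => by simp
  have hsq : ∀ v, ∑ g, ρ g (ρ g v) = 0 := by
    intro v
    rw [← hsum v]
    refine Fintype.sum_equiv (powCoprime (n := 2) hodd.coprime_two_right) _ _ fun k => ?_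
    rw [powCoprime_apply, pow_two, map_mul, Module.End.mul_apply]
  let S : V → V → V →ₗ[F] V := fun u y => ∑ g, (B.flip u ∘ₗ ρ g).smulRight (ρ g⁻¹ y)
  have hS : ∀ u y x, S u y x = ∑ g, B (ρ g x) u • ρ g⁻¹ y := fun u y x => by simp [S]
  have hSmem : ∀ u y, S u y ∈ EquivHom ρ ρ := by
    intro u y k x
    rw [hS, hS, map_sum]
    refine Fintype.sum_equiv (Equiv.mulRight k) _ _ fun g => ?_
    simp only [Equiv.coe_mulRight, mul_inv_rev, map_smul, map_mul, Module.End.mul_apply]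
    rw [← Module.End.mul_apply (ρ k) (ρ k⁻¹), ← map_mul, mul_inv_cancel, map_one,
      Module.End.one_apply]
  choose c hc using fun u y => hend (S u y) (hSmem u y)
  have hcS : ∀ u y x, ∑ g, B (ρ g x) u • ρ g⁻¹ y = c u y • x := fun u y x => by
    rw [← hS, hc, LinearMap.smul_apply, LinearMap.id_apply]
  let b := Module.finBasis F V
  choose u hu using fun i => hnd.flip.bijective.2 (b.coord i)
  have hu' : ∀ i z, B z (u i) = b.repr z i := fun i z => LinearMap.congr_fun (hu i) z
  have htrace : ∑ i, c (u i) (b i) = Nat.card G := by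
    obtain ⟨x, hx⟩ := exists_ne (0 : V)
    refine smul_left_injective F hx ?_
    simp only [Finset.sum_smul]
    simp_rw [← hcS, hu']
    rw [Finset.sum_comm]
    have : ∀ g, ∑ i, b.repr (ρ g x) i • ρ g⁻¹ (b i) = x := fun g => by
      simp_rw [← map_smul, ← map_sum]
      rw [b.sum_repr, ← Module.End.mul_apply, ← map_mul, inv_mul_cancel, map_one,
        Module.End.one_apply]
    simp [this, Nat.card_eq_fintype_card, Nat.cast_smul_eq_nsmul]
  have hinv : ∀ g y z, B (ρ g⁻¹ y) z = B y (ρ g z) := fun g y z => by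
    rw [← hB g, ← Module.End.mul_apply, ← map_mul, mul_inv_cancel, map_one,
        Module.End.one_apply]
  have hzero : ∀ y x, ∑ i, c (u i) y * B x (b i) = 0 := by
    intro y x
    calc ∑ i, c (u i) y * B x (b i)
        = ∑ i, B (∑ g, B (ρ g x) (u i) • ρ g⁻¹ y) (b i) := by
          simp [hcS]
      _ = ∑ g, B y (ρ g (∑ i, b.repr (ρ g x) i • b i)) := by
          simp only [map_sum, LinearMap.sum_apply, map_smul, LinearMap.smul_apply, hinv, hu']
          exact Finset.sum_comm
      _ = B y (∑ g, ρ g (ρ g x)) := by simp_rw [b.sum_repr, map_sum]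
      _ = 0 := by rw [hsq, map_zero]
  refine hcard ?_
  rw [← htrace]
  refine Finset.sum_eq_zero fun j _ => ?_
  obtain ⟨x, hx⟩ := hnd.bijective.2 (b.coord j)
  have := hzero (b j) x
  simp only [hx, Basis.coord_apply, Basis.repr_self, Finsupp.single_apply] at this
  simpa using this

theorem repIso_of_equivHom_ne_zero {ρ : Representation F G V} {τ : Representation F G W}
    (hρ : IsIrred ρ) (hτ : IsIrred τ) {f : V →ₗ[F] W} (hf : f ∈ EquivHom ρ τ) (hf0 : f ≠ 0) :
    RepIso ρ τ := by
  have hker : LinearMap.ker f = ⊥ := by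
    refine (hρ.2 _ fun g v hv => ?_).resolve_right fun h => hf0 (LinearMap.ker_eq_top.1 h)
    rw [LinearMap.mem_ker] at hv ⊢
    rw [hf g v, hv, map_zero]
  have hrange : LinearMap.range f = ⊤ := by
    refine (hτ.2 _ ?_).resolve_left fun h => hf0 (LinearMap.range_eq_bot.1 h)
    rintro g _ ⟨v, rfl⟩
    exact ⟨ρ g v, hf g v⟩
  exact ⟨LinearEquiv.ofBijective f ⟨LinearMap.ker_eq_bot.1 hker, LinearMap.range_eq_top.1 hrange⟩,
    fun g v => hf g v⟩

theorem RepIso.symm {ρ : Representation F G V} {τ : Representation F G W} (h : RepIso ρ τ) :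
    RepIso τ ρ := by
  obtain ⟨e, he⟩ := h
  exact ⟨e.symm, fun g w => e.injective (by simp [he])⟩

theorem RepIso.trans {X : Type} [AddCommGroup X] [Module F X] {ρ : Representation F G V}
    {τ : Representation F G W} {κ : Representation F G X} (h : RepIso ρ τ) (h' : RepIso τ κ) :
    RepIso ρ κ := by
  obtain ⟨e, he⟩ := h
  obtain ⟨e', he'⟩ := h'
  exact ⟨e.trans e', fun g v => by simp [he, he']⟩

theorem IsSplitting.of_subgroup_top (h : IsSplitting F (⊤ : Subgroup G)) : IsSplitting F G := by
  intro V _ _ ρ hfd hirr f hf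
  refine h V (ρ.comp (⊤ : Subgroup G).subtype) hfd
    ⟨hirr.1, fun U hU => hirr.2 U fun g v hv => hU ⟨g, trivial⟩ v hv⟩ f fun g v => hf g v

end Forms

section Clifford

variable {F : Type} [Field F] {G : Type} [Group G] {N : Subgroup G}
variable {V W : Type} [AddCommGroup V] [Module F V] [AddCommGroup W] [Module F W]

theorem mem_invariants_linHom_iff {ρ : Representation F G W} {τ : Representation F G V}
    {f : W →ₗ[F] V} :
    f ∈ (ρ.linHom τ).invariants ↔ f ∈ EquivHom ρ τ := by
  have hinv : ∀ g w, ρ g⁻¹ (ρ g w) = w := fun g w => by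
    rw [← Module.End.mul_apply, ← map_mul, inv_mul_cancel, map_one, Module.End.one_apply]
  have hinv' : ∀ g w, ρ g (ρ g⁻¹ w) = w := fun g w => by
    rw [← Module.End.mul_apply, ← map_mul, mul_inv_cancel, map_one, Module.End.one_apply]
  constructor
  · intro h g w
    have := LinearMap.congr_fun (h g) (ρ g w)
    simp only [Representation.linHom_apply, LinearMap.comp_apply, hinv] at this
    exact this.symm
  · intro h g
    refine LinearMap.ext fun w => ?_
    simp only [Representation.linHom_apply, LinearMap.comp_apply]
    rw [← h g, hinv']

variable [N.Normal]

/-- `R` intertwines `σ` with its conjugate by `g` and preserves the form `B`. -/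
def IsIsometricTwist (σ : Representation F N W) (B : W →ₗ[F] W →ₗ[F] F) (g : G)
    (R : W →ₗ[F] W) : Prop :=
  (∀ (n : N) (w : W), R (σ n w) = σ (MulAut.conjNormal g n) (R w)) ∧
    ∀ v w, B (R v) (R w) = B v w

theorem IsIsometricTwist.eq [CharP F 2] [FiniteDimensional F W] {σ : Representation F N W}
    (hW : Nontrivial W)
    (hend : ∀ f ∈ EquivHom σ σ, ∃ c : F, f = c • (LinearMap.id : W →ₗ[F] W))
    {B : W →ₗ[F] W →ₗ[F] F} (hnd : Nondeg B) {g : G} {R R' : W →ₗ[F] W}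
    (hR : IsIsometricTwist σ B g R) (hR' : IsIsometricTwist σ B g R') : R = R' := by
  have hinj := hnd.injective_of_preserves hR.2
  let e := LinearEquiv.ofBijective R ⟨hinj, LinearMap.injective_iff_surjective.1 hinj⟩
  have he : ∀ w, R (e.symm w) = w := e.apply_symm_apply
  obtain ⟨c, hc⟩ := hend (e.symm.toLinearMap ∘ₗ R') fun n w => hinj <| by
    simp only [LinearMap.comp_apply, LinearEquiv.coe_coe]
    rw [he, hR.1, he, hR'.1]
  have hcR : ∀ w, R' w = c • R w := fun w => by
    have := congrArg R (LinearMap.congr_fun hc w)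
    simpa [he] using this
  obtain ⟨v, hv⟩ := exists_ne (0 : W)
  obtain ⟨w, hw⟩ : ∃ w, B v w ≠ 0 := by
    by_contra! h
    exact hv (hnd v h)
  have hc2 : c ^ 2 = 1 := by
    have := hR'.2 v w
    rw [hcR, hcR, map_smul, map_smul, LinearMap.smul_apply, hR.2, smul_eq_mul, smul_eq_mul,
      ← mul_assoc, ← pow_two] at this
    exact mul_right_cancel₀ hw (this.trans (one_mul _).symm)
  have hc1 : c = 1 := by
    refine frobenius_inj F 2 ?_
    simpa [frobenius_def] using hc2
  exact LinearMap.ext fun w => by rw [hcR, hc1, one_smul]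

theorem exists_isIsometricTwist [CharP F 2] [PerfectField F] [FiniteDimensional F W]
    {σ : Representation F N W} (hW : Nontrivial W)
    (hend : ∀ f ∈ EquivHom σ σ, ∃ c : F, f = c • (LinearMap.id : W →ₗ[F] W))
    {B : W →ₗ[F] W →ₗ[F] F} (hB : BilinInvariant σ B) (hnd : Nondeg B) (g : G)
    (hg : RepIso σ (σ.comp (MulAut.conjNormal g).toMonoidHom)) :
    ∃ R, IsIsometricTwist σ B g R := by
  obtain ⟨P, hP⟩ := hg
  replace hP : ∀ n w, P (σ n w) = σ (MulAut.conjNormal g n) (P w) := hP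
  obtain ⟨c, hc⟩ := exists_eq_mul_of_bilinInvariant hend hB hnd
    (C := B.compl₁₂ P.toLinearMap P.toLinearMap) fun n v w => by
      simp only [LinearMap.compl₁₂_apply, LinearEquiv.coe_coe]
      rw [hP, hP, hB]
  simp only [LinearMap.compl₁₂_apply, LinearEquiv.coe_coe] at hc
  have hc0 : c ≠ 0 := by
    rintro rfl
    obtain ⟨v, hv⟩ := exists_ne (0 : W)
    refine hv (P.map_eq_zero_iff.1 (hnd _ fun w => ?_))
    rw [← P.apply_symm_apply w, hc, zero_mul]
  obtain ⟨d, hd⟩ := surjective_frobenius F 2 c⁻¹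
  rw [frobenius_def] at hd
  refine ⟨d • P.toLinearMap, fun n w => ?_, fun v w => ?_⟩
  · simp [hP]
  · simp only [LinearMap.smul_apply, LinearEquiv.coe_coe, map_smul, smul_eq_mul]
    rw [hc, ← mul_assoc, ← pow_two, hd, inv_mul_cancel_left₀ hc0]

/-- The isometric extension of an invariant self-dual absolutely irreducible representation. -/
theorem exists_extension [CharP F 2] [PerfectField F] [FiniteDimensional F W]
    {σ : Representation F N W} (hW : Nontrivial W)
    (hend : ∀ f ∈ EquivHom σ σ, ∃ c : F, f = c • (LinearMap.id : W →ₗ[F] W))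
    {B : W →ₗ[F] W →ₗ[F] F} (hB : BilinInvariant σ B) (hnd : Nondeg B)
    (hinv : ∀ g : G, RepIso σ (σ.comp (MulAut.conjNormal g).toMonoidHom)) :
    ∃ ρ : Representation F G W,
      (∀ (n : N) (w : W), ρ (n : G) w = σ n w) ∧ BilinInvariant ρ B := by
  choose R hR using fun g => exists_isIsometricTwist hW hend hB hnd g (hinv g)
  have huniq : ∀ {g R'}, IsIsometricTwist σ B g R' → R g = R' := fun h =>
    (hR _).eq hW hend hnd h
  refine ⟨⟨⟨R, huniq ⟨fun n w => by simp, fun v w => rfl⟩⟩, fun g h => huniq ⟨fun n w => ?_,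
    fun v w => ?_⟩⟩, fun n w => LinearMap.congr_fun (huniq (R' := σ n)
      ⟨fun m w => ?_, fun v w => hB n v w⟩) w, fun g v w => (hR g).2 v w⟩
  · simp [(hR _).1]
  · simp [(hR _).2]
  · rw [← Module.End.mul_apply, ← Module.End.mul_apply, ← map_mul, ← map_mul]
    congr 2
    ext
    simp

/-- A self-dual irreducible representation lying over `σ` is isomorphic to any isometric
extension of `σ`. -/
theorem repIso_of_extension [CharP F 2] [Finite G] (hodd : Odd N.index)
    (hsplit : IsSplitting F G) [FiniteDimensional F W] {σ : Representation F N W}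
    (hendσ : ∀ f ∈ EquivHom σ σ, ∃ c : F, f = c • (LinearMap.id : W →ₗ[F] W))
    {BW : W →ₗ[F] W →ₗ[F] F} (hBWnd : Nondeg BW)
    {ρ : Representation F G W} (hρσ : ∀ (n : N) (w : W), ρ (n : G) w = σ n w)
    (hBW : BilinInvariant ρ BW) (hρ : IsIrred ρ) [FiniteDimensional F V]
    {τ : Representation F G V} (hτ : IsIrred τ) (hτsd : IsSelfDual τ)
    (hover : EquivHom σ (τ.comp N.subtype) ≠ ⊥) : RepIso ρ τ := by
  obtain ⟨BV, hBV, hBVnd⟩ := hτsd.exists_form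
  have hσ : ρ.comp N.subtype = σ := MonoidHom.ext fun n => LinearMap.ext fun w => hρσ n w
  subst hσ
  have hWnt := hρ.1
  let κ := (ρ.linHom τ).quotientToInvariants N
  let U := Representation.invariants ((ρ.linHom τ).comp N.subtype)
  have hU : ∀ f : W →ₗ[F] V, f ∈ U ↔ f ∈ EquivHom (ρ.comp N.subtype) (τ.comp N.subtype) :=
    fun f => mem_invariants_linHom_iff (ρ := ρ.comp N.subtype) (τ := τ.comp N.subtype)
  have hκ : ∀ (g : G) (f : U) w, (κ g f).1 w = τ g (f.1 (ρ g⁻¹ w)) := fun _ _ _ => rfl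
  obtain ⟨w₁, hw₁⟩ := exists_ne (0 : W)
  obtain ⟨w₂, hw₂⟩ : ∃ w₂, BW w₁ w₂ = 1 := by
    obtain ⟨w, hw⟩ : ∃ w, BW w₁ w ≠ 0 := by
      by_contra! h
      exact hw₁ (hBWnd _ h)
    exact ⟨(BW w₁ w)⁻¹ • w, by simp [hw]⟩
  let β : U →ₗ[F] U →ₗ[F] F := BV.compl₁₂
    (LinearMap.applyₗ w₁ ∘ₗ U.subtype) (LinearMap.applyₗ w₂ ∘ₗ U.subtype)
  have hβ : ∀ (f f' : U) (v w : W), BV (f.1 v) (f'.1 w) = β f f' * BW v w := by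
    intro f f'
    obtain ⟨c, hc⟩ := exists_eq_mul_of_bilinInvariant hendσ (fun n v w => hBW n v w) hBWnd
      (C := BV.compl₁₂ f.1 f'.1) fun n v w => by
        simp only [LinearMap.compl₁₂_apply]
        rw [(hU _).1 f.2 n, (hU _).1 f'.2 n]
        exact hBV n _ _
    simp only [LinearMap.compl₁₂_apply] at hc
    have : β f f' = c := (hc w₁ w₂).trans (by rw [hw₂, mul_one])
    rw [this]
    exact hc
  -- The images of a nonzero invariant subspace of `U` span `V`, hence it has no orthogonal.
  have horth : ∀ A : Submodule F U, IsSubrep κ A → A ≠ ⊥ →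
      ∀ f : U, (∀ a ∈ A, β f a = 0) → f = 0 := by
    intro A hA hA0 f hf
    have hspan : Submodule.span F {v | ∃ a ∈ A, ∃ w, a.1 w = v} = ⊤ := by
      refine (hτ.2 _ fun g v hv => ?_).resolve_left fun h => hA0 ?_
      · induction hv using Submodule.span_induction with
        | mem x hx =>
          obtain ⟨a, ha, w, rfl⟩ := hx
          refine Submodule.subset_span ⟨κ g a, hA g a ha, ρ g w, ?_⟩
          rw [hκ, ← Module.End.mul_apply, ← map_mul, inv_mul_cancel, map_one,
            Module.End.one_apply]
        | zero => rw [map_zero]; exact zero_mem _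
        | add x y _ _ hx hy => rw [map_add]; exact add_mem hx hy
        | smul c x _ hx => rw [map_smul]; exact Submodule.smul_mem _ _ hx
      · rw [Submodule.span_eq_bot] at h
        refine (Submodule.eq_bot_iff _).2 fun a ha => ?_
        exact Subtype.ext (LinearMap.ext fun w => h _ ⟨a, ha, w, rfl⟩)
    refine Subtype.ext (LinearMap.ext fun w => hBVnd _ fun v => ?_)
    have hv : v ∈ Submodule.span F {v | ∃ a ∈ A, ∃ w, a.1 w = v} := hspan ▸ Submodule.mem_top
    induction hv using Submodule.span_induction with
    | mem x hx =>
      obtain ⟨a, ha, w', rfl⟩ := hx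
      rw [hβ, hf a ha, zero_mul]
    | zero => rw [map_zero]
    | add x y _ _ hx hy => rw [map_add, hx, hy, add_zero]
    | smul c x _ hx => rw [map_smul, hx, smul_zero]
  have hUnt : Nontrivial U := by
    obtain ⟨f, hf, hf0⟩ := Submodule.exists_mem_ne_zero_of_ne_bot hover
    exact ⟨⟨f, (hU f).2 hf⟩, 0, fun h => hf0 (congrArg Subtype.val h)⟩
  have hβnd : Nondeg β := fun f hf =>
    horth ⊤ (fun _ _ _ => Submodule.mem_top) top_ne_bot f fun a _ => hf a
  have hirr : IsIrred (κ.comp (QuotientGroup.mk' N)) := by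
    refine ⟨hUnt, fun A hA => or_iff_not_imp_left.2 fun hA0 => ?_⟩
    by_contra hAtop
    obtain ⟨φ, hφ, hAφ⟩ := A.exists_le_ker_of_lt_top (lt_top_iff_ne_top.2 hAtop)
    obtain ⟨f, rfl⟩ := hβnd.bijective.2 φ
    refine hφ ?_
    rw [horth A (fun q => QuotientGroup.induction_on q hA) hA0 f fun a ha => hAφ ha, map_zero]
  have hend : ∀ f ∈ EquivHom κ κ, ∃ c : F, f = c • (LinearMap.id : U →ₗ[F] U) := fun f hf =>
    hsplit U (κ.comp (QuotientGroup.mk' N)) inferInstance hirr f fun g v => hf g v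
  have hβinv : BilinInvariant κ β := by
    intro q
    refine QuotientGroup.induction_on q fun g f f' => ?_
    have h := hβ (κ g f) (κ g f') (ρ g w₁) (ρ g w₂)
    rw [hκ, hκ, hBV, hBW, ← Module.End.mul_apply, ← Module.End.mul_apply, ← map_mul,
      inv_mul_cancel, map_one, Module.End.one_apply, Module.End.one_apply, hβ, hw₂, mul_one,
      mul_one] at h
    exact h.symm
  have hcard : (Nat.card (G ⧸ N) : F) ≠ 0 := by
    rw [Ne, CharP.cast_eq_zero_iff F 2]
    exact hodd.not_two_dvd_nat
  obtain ⟨f, hf0, hf⟩ := exists_ne_zero_forall_apply_eq_of_odd_card hodd hcard hend hβinv hβnd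
  refine repIso_of_equivHom_ne_zero hρ hτ (f := f.1) (mem_invariants_linHom_iff.1 fun g => ?_)
    fun h => hf0 (Subtype.ext h)
  exact congrArg Subtype.val (hf g)

end Clifford

/-- |G:N| odd, W a G-invariant self-dual irreducible FN-module; there is exactly
one self-dual irreducible FG-module lying over W, namely the unique self-dual extension. -/
theorem stmt_7 {F : Type} [Field F] [CharP F 2] [PerfectField F]
    {G : Type} [Group G] [Finite G] (N : Subgroup G) [N.Normal]
    (hodd : Odd N.index) (hsplit : ∀ H : Subgroup G, IsSplitting F ↥H)
    {W : Type} [AddCommGroup W] [Module F W] [FiniteDimensional F W]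
    (σ : Representation F ↥N W) (hirr : IsIrred σ) (hsd : IsSelfDual σ)
    (hGinv : ∀ g : G, RepIso σ (σ.comp (MulAut.conjNormal g).toMonoidHom)) :
    (∃ ρ : Representation F G W,
      (∀ (n : ↥N) (w : W), ρ (n : G) w = σ n w) ∧ IsSelfDual ρ ∧ IsIrred ρ) ∧
    (∀ (V₁ : Type) [AddCommGroup V₁] [Module F V₁] (ρ₁ : Representation F G V₁)
        (V₂ : Type) [AddCommGroup V₂] [Module F V₂] (ρ₂ : Representation F G V₂),
      FiniteDimensional F V₁ → IsIrred ρ₁ → IsSelfDual ρ₁ →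
        EquivHom σ (ρ₁.comp N.subtype) ≠ ⊥ →
      FiniteDimensional F V₂ → IsIrred ρ₂ → IsSelfDual ρ₂ →
        EquivHom σ (ρ₂.comp N.subtype) ≠ ⊥ →
      RepIso ρ₁ ρ₂) := by
  have hend := hsplit N W σ inferInstance hirr
  obtain ⟨B, hB, hnd⟩ := hsd.exists_form
  obtain ⟨ρ, hρσ, hρB⟩ := exists_extension hirr.1 hend hB hnd hGinv
  have hρ : IsIrred ρ :=
    ⟨hirr.1, fun U hU => hirr.2 U fun n w hw => hρσ n w ▸ hU n w hw⟩
  refine ⟨⟨ρ, hρσ, isSelfDual_of_form hρB hnd, hρ⟩, ?_⟩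
  intro V₁ _ _ ρ₁ V₂ _ _ ρ₂ hfd₁ hirr₁ hsd₁ hover₁ hfd₂ hirr₂ hsd₂ hover₂
  have hG := (hsplit ⊤).of_subgroup_top
  exact (repIso_of_extension hodd hG hend hnd hρσ hρB hρ hirr₁ hsd₁ hover₁).symm.trans
    (repIso_of_extension hodd hG hend hnd hρσ hρB hρ hirr₂ hsd₂ hover₂)
end

section
/- Let G be a finite group, N a normal subgroup of odd index, F a perfect splitting field of characteristic 2, and V a self-dual irreducible FG-module. Then the restriction V↓_N is a direct sum of pairwise non-isomorphic self-dual irreducible FN-modules (i.e. it is multiplicity-free and every summand is self-dual). -/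
open Module

section InvariantForms

variable {F : Type} [Field F] {H : Type} [Group H]
variable {U : Type} [AddCommGroup U] [Module F U]

theorem IsIrred.injective_of_bilinInvariant {τ : Representation F H U} (hτ : IsIrred τ)
    {β : U →ₗ[F] U →ₗ[F] F} (hβ : BilinInvariant τ β) (h0 : β ≠ 0) :
    Function.Injective β := by
  rw [← LinearMap.ker_eq_bot]
  refine (hτ.2 (LinearMap.ker β) ?_).resolve_right fun h => h0 (LinearMap.ker_eq_top.1 h)
  intro g v hv
  rw [LinearMap.mem_ker] at hv ⊢
  ext w
  have h := hβ g v (τ g⁻¹ w)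
  rw [Representation.self_inv_apply] at h
  simp [h, hv]

theorem IsIrred.eq_smul_of_bilinInvariant [FiniteDimensional F U] {τ : Representation F H U}
    (hτ : IsIrred τ) (hs : IsSplitting F H) {β γ : U →ₗ[F] U →ₗ[F] F}
    (hβ : BilinInvariant τ β) (h0 : β ≠ 0) (hγ : BilinInvariant τ γ) :
    ∃ c : F, γ = c • β := by
  have hinj := hτ.injective_of_bilinInvariant hβ h0
  let e : U ≃ₗ[F] Dual F U :=
    LinearMap.linearEquivOfInjective β hinj Subspace.dual_finrank_eq.symm
  have he : ∀ u, β (e.symm u) = u := fun u => e.apply_symm_apply u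
  obtain ⟨c, hc⟩ := hs U τ inferInstance hτ (e.symm.toLinearMap ∘ₗ γ) (by
    intro g w
    apply hinj
    ext x
    have h1 := hβ g (e.symm (γ w)) (τ g⁻¹ x)
    have h2 := hγ g w (τ g⁻¹ x)
    rw [Representation.self_inv_apply] at h1 h2
    simp only [LinearMap.comp_apply, LinearEquiv.coe_coe, he, h1, h2])
  refine ⟨c, LinearMap.ext fun u => ?_⟩
  have h := congrArg β (LinearMap.congr_fun hc u)
  simpa [he] using h

theorem exists_add_flip_eq_of_isAltForm [CharP F 2] [FiniteDimensional F U]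
    {β : U →ₗ[F] U →ₗ[F] F} (hβ : IsAltForm β) :
    ∃ γ : U →ₗ[F] U →ₗ[F] F, γ + γ.flip = β := by
  let b := Module.finBasis F U
  refine ⟨b.constr F fun i => b.constr F fun j => if i < j then β (b i) (b j) else 0, ?_⟩
  refine b.ext fun i => b.ext fun j => ?_
  simp only [LinearMap.add_apply, LinearMap.flip_apply, Basis.constr_basis]
  have hswap : β (b j) (b i) = β (b i) (b j) := by
    have h := hβ (b i + b j)
    simp only [map_add, LinearMap.add_apply, hβ (b i), hβ (b j), zero_add, add_zero] at h
    exact CharTwo.add_eq_zero.1 h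
  rcases lt_trichotomy i j with h | h | h
  · simp [h, h.not_gt]
  · subst h
    simp [hβ (b i)]
  · simp [h, h.not_gt, hswap]

theorem exists_bilinInvariant_average {L : Subgroup H} [L.Normal] [Finite (H ⧸ L)]
    {τ : Representation F H U} (hL : ∀ l ∈ L, τ l = 1) {β γ : U →ₗ[F] U →ₗ[F] F}
    (hβ : BilinInvariant τ β) (hγ : γ + γ.flip = β) :
    ∃ γ' : U →ₗ[F] U →ₗ[F] F, BilinInvariant τ γ' ∧
      γ' + γ'.flip = (L.index : F) • β := by
  classical
  have := Fintype.ofFinite (H ⧸ L)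
  let t : H ⧸ L →* Module.End F U := QuotientGroup.lift L τ fun l hl => hL l hl
  have ht : ∀ h : H, t (h : H ⧸ L) = τ h := fun h => rfl
  refine ⟨∑ q : H ⧸ L, γ.compl₁₂ (t q) (t q), ?_, ?_⟩
  · intro g v w
    simp only [LinearMap.sum_apply, LinearMap.compl₁₂_apply]
    refine Fintype.sum_equiv (Equiv.mulRight (g : H ⧸ L)) _ _ fun q => ?_
    simp [ht]
  · ext v w
    have hq : ∀ q : H ⧸ L, γ (t q v) (t q w) + γ (t q w) (t q v) = β v w := by
      intro q
      obtain ⟨h, rfl⟩ := QuotientGroup.mk_surjective q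
      rw [ht, ← hβ h v w, ← hγ]
      rfl
    simp only [LinearMap.add_apply, LinearMap.flip_apply, LinearMap.sum_apply,
      LinearMap.compl₁₂_apply, ← Finset.sum_add_distrib, hq]
    simp [Subgroup.index, Nat.card_eq_fintype_card]

theorem IsIrred.not_isAltForm_of_odd_index [CharP F 2] [FiniteDimensional F U]
    {L : Subgroup H} [L.Normal] (hodd : Odd L.index) {τ : Representation F H U}
    (hτ : IsIrred τ) (hs : IsSplitting F H) (hL : ∀ l ∈ L, τ l = 1)
    {β : U →ₗ[F] U →ₗ[F] F} (hβ : BilinInvariant τ β) (h0 : β ≠ 0)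
    (hflip : β.flip = β) : ¬ IsAltForm β := by
  intro halt
  have : L.FiniteIndex := ⟨fun h => by simp [h] at hodd⟩
  obtain ⟨γ, hγ⟩ := exists_add_flip_eq_of_isAltForm halt
  obtain ⟨γ', hγ', hsum⟩ := exists_bilinInvariant_average hL hβ hγ
  obtain ⟨c, rfl⟩ := hτ.eq_smul_of_bilinInvariant hs hβ h0 hγ'
  have hone : (L.index : F) = 1 := by
    obtain ⟨k, hk⟩ := hodd
    simp [hk, CharTwo.two_eq_zero]
  have hc : (c • β).flip = c • β := by
    conv_rhs => rw [← hflip]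
    rfl
  rw [hc, hone, one_smul, ← add_smul, CharTwo.add_self_eq_zero, zero_smul] at hsum
  exact h0 hsum.symm

theorem exists_sq_eq_of_perfectField [CharP F 2] [PerfectField F] (a : F) :
    ∃ m : F, m ^ 2 = a := by
  have : ExpChar F 2 := .prime Nat.prime_two
  have := PerfectField.toPerfectRing (K := F) 2
  exact surjective_frobenius F 2 a

theorem eq_one_of_sq_eq_one [CharP F 2] {c : F} (h : c ^ 2 = 1) : c = 1 := by
  have : (c - 1) ^ 2 = 0 := by
    rw [CharTwo.sub_eq_add, CharTwo.add_sq, h]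
    simp [CharTwo.add_self_eq_zero]
  exact sub_eq_zero.1 (pow_eq_zero_iff two_ne_zero |>.1 this)

theorem IsIrred.flip_eq_of_bilinInvariant [CharP F 2] [FiniteDimensional F U]
    {τ : Representation F H U} (hτ : IsIrred τ) (hs : IsSplitting F H)
    {β : U →ₗ[F] U →ₗ[F] F} (hβ : BilinInvariant τ β) (h0 : β ≠ 0) : β.flip = β := by
  obtain ⟨c, hc⟩ := hτ.eq_smul_of_bilinInvariant hs hβ h0 (γ := β.flip)
    fun g v w => hβ g w v
  have hcc : ∀ u v, β v u = c * β u v := fun u v => LinearMap.congr_fun₂ hc u v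
  obtain ⟨u, v, huv⟩ : ∃ u v, β u v ≠ 0 := by
    by_contra! h
    exact h0 (LinearMap.ext₂ h)
  have hc1 : c ^ 2 = 1 := by
    have h := hcc v u
    rw [hcc u v, ← mul_assoc] at h
    exact mul_right_cancel₀ huv (by rw [one_mul, pow_two, ← h])
  rw [hc, eq_one_of_sq_eq_one hc1, one_smul]

/-- An absolutely irreducible self-dual representation in characteristic two that is trivial on a
normal subgroup of odd index is one-dimensional. -/
theorem IsIrred.finrank_eq_one_of_odd_index [CharP F 2] [PerfectField F]
    [FiniteDimensional F U] {L : Subgroup H} [L.Normal] (hodd : Odd L.index)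
    {τ : Representation F H U} (hτ : IsIrred τ) (hs : IsSplitting F H)
    (hL : ∀ l ∈ L, τ l = 1) {β : U →ₗ[F] U →ₗ[F] F} (hβ : BilinInvariant τ β) (h0 : β ≠ 0) :
    finrank F U = 1 := by
  have hflip := hτ.flip_eq_of_bilinInvariant hs hβ h0
  have hsymm : ∀ u v, β u v = β v u := fun u v => (LinearMap.congr_fun₂ hflip v u :)
  let K : Submodule F U :=
    { carrier := {v | β v v = 0}
      add_mem' := by
        intro v w hv hw
        simp only [Set.mem_ofPred_eq] at hv hw ⊢
        simp [hv, hw, hsymm w v, CharTwo.add_self_eq_zero]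
      zero_mem' := by simp
      smul_mem' := by
        intro c v hv
        simp only [Set.mem_ofPred_eq] at hv ⊢
        simp [hv] }
  have hKbot : K = ⊥ := by
    refine (hτ.2 K ?_).resolve_right fun h => ?_
    · intro g v hv
      exact (hβ g v v).trans hv
    · refine hτ.not_isAltForm_of_odd_index hodd hs hL hβ h0 hflip fun v => ?_
      exact (h ▸ Submodule.mem_top : v ∈ K)
  have haniso : ∀ v, β v v = 0 → v = 0 := fun v hv =>
    (Submodule.mem_bot F).1 (hKbot ▸ (show v ∈ K from hv))
  have := hτ.1
  obtain ⟨v, hv⟩ := exists_ne (0 : U)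
  refine finrank_eq_one v hv fun u => ?_
  obtain ⟨m, hm⟩ := exists_sq_eq_of_perfectField (β u u / β v v)
  refine ⟨m, ?_⟩
  have hvv : β v v ≠ 0 := fun h => hv (haniso v h)
  have hmul : m * (m * β v v) = β u u := by
    rw [← mul_assoc, ← pow_two, hm, div_mul_cancel₀ _ hvv]
  refine sub_eq_zero.1 (haniso _ ?_)
  simp only [map_sub, map_smul, LinearMap.sub_apply, LinearMap.smul_apply, smul_eq_mul,
    hsymm u v]
  linear_combination hmul + (β u u - m * β v u) * CharTwo.two_eq_zero (R := F)

end InvariantForms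

section Twisted

variable {F : Type} [Field F] {G : Type} [Group G] {N : Subgroup G} [N.Normal]
variable {W : Type} [AddCommGroup W] [Module F W]

/-- `φ` intertwines `σ` with its conjugate by `g`. -/
def IsTwisted (σ : Representation F ↥N W) (g : G) (φ : W →ₗ[F] W) : Prop :=
  ∀ (n : N) (w : W), φ (σ n w) = σ (MulAut.conjNormal g n) (φ w)

/-- `c` is an invariant pairing between the conjugate of `σ` by `g` and `σ`. -/
def IsTwistedPairing (σ : Representation F ↥N W) (g : G) (c : W →ₗ[F] W →ₗ[F] F) : Prop :=
  ∀ (n : N) (w w' : W), c (σ (MulAut.conjNormal g n) w) (σ n w') = c w w'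

variable {σ : Representation F ↥N W} {g g' : G}

theorem isTwistedPairing_one_iff {c : W →ₗ[F] W →ₗ[F] F} :
    IsTwistedPairing σ 1 c ↔ BilinInvariant σ c := by
  simp [IsTwistedPairing, BilinInvariant]

theorem IsTwistedPairing.flip {c : W →ₗ[F] W →ₗ[F] F} (hc : IsTwistedPairing σ g c) :
    IsTwistedPairing σ g⁻¹ c.flip := by
  intro n w w'
  have h := hc (MulAut.conjNormal g⁻¹ n) w' w
  rwa [← MulAut.mul_apply, ← map_mul, mul_inv_cancel, map_one, MulAut.one_apply] at h

theorem IsTwistedPairing.injective {c : W →ₗ[F] W →ₗ[F] F} (hc : IsTwistedPairing σ g c)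
    (hσ : IsIrred σ) (h0 : c ≠ 0) : Function.Injective c := by
  rw [← LinearMap.ker_eq_bot]
  refine (hσ.2 (LinearMap.ker c) ?_).resolve_right fun h => h0 (LinearMap.ker_eq_top.1 h)
  intro n v hv
  rw [LinearMap.mem_ker] at hv ⊢
  ext w
  have h := hc (MulAut.conjNormal g⁻¹ n) v (σ (MulAut.conjNormal g⁻¹ n)⁻¹ w)
  rw [Representation.self_inv_apply, ← MulAut.mul_apply, ← map_mul, mul_inv_cancel, map_one,
    MulAut.one_apply] at h
  simp [h, hv]

theorem IsTwistedPairing.exists_isTwisted [FiniteDimensional F W] (hσ : IsIrred σ)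
    {c c' : W →ₗ[F] W →ₗ[F] F} (hc : IsTwistedPairing σ g c) (h0 : c ≠ 0)
    (hc' : IsTwistedPairing σ g' c') (h0' : c' ≠ 0) :
    ∃ φ : W ≃ₗ[F] W, IsTwisted σ (g'⁻¹ * g) φ := by
  have flip_ne : ∀ {d : W →ₗ[F] W →ₗ[F] F}, d ≠ 0 → d.flip ≠ 0 := fun hd h =>
    hd (by ext x y; exact LinearMap.congr_fun₂ h y x)
  have hinj := hc.flip.injective hσ (flip_ne h0)
  have hinj' := hc'.flip.injective hσ (flip_ne h0')
  let e := LinearMap.linearEquivOfInjective c.flip hinj Subspace.dual_finrank_eq.symm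
  let e' := LinearMap.linearEquivOfInjective c'.flip hinj' Subspace.dual_finrank_eq.symm
  let φ := e.trans e'.symm
  have hφ : ∀ w x, c' w (φ x) = c w x := fun w x =>
    LinearMap.congr_fun (e'.apply_symm_apply (e x)) w
  refine ⟨φ, fun n x => hinj' (LinearMap.ext fun w => ?_)⟩
  obtain ⟨w, rfl⟩ : ∃ y, σ (MulAut.conjNormal g n) y = w :=
    ⟨_, Representation.self_inv_apply σ _ w⟩
  have h := hc' (MulAut.conjNormal (g'⁻¹ * g) n) w (φ x)
  rw [← MulAut.mul_apply, ← map_mul, mul_inv_cancel_left] at h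
  simp only [LinearMap.flip_apply, LinearEquiv.coe_coe]
  rw [hφ, h, hφ, hc]

theorem IsTwisted.mul {φ φ' : W →ₗ[F] W} (h : IsTwisted σ g φ) (h' : IsTwisted σ g' φ') :
    IsTwisted σ (g * g') (φ * φ') := by
  intro n w
  rw [Module.End.mul_apply, h', h, map_mul, MulAut.mul_apply, Module.End.mul_apply]

theorem isTwisted_coe (n : N) : IsTwisted σ (n : G) (σ n) := by
  intro m w
  have h : MulAut.conjNormal (n : G) m = n * m * n⁻¹ := by
    ext
    simp [MulAut.conjNormal_apply]
  rw [h, ← Module.End.mul_apply, ← Module.End.mul_apply, ← map_mul, ← map_mul,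
    inv_mul_cancel_right]

/-- The inertia group of `σ`: those `g` for which `σ` is isomorphic to its conjugate. -/
def inertiaGroup (σ : Representation F ↥N W) : Subgroup G where
  carrier := {g | ∃ φ : W ≃ₗ[F] W, IsTwisted σ g φ}
  mul_mem' := by
    rintro g g' ⟨φ, hφ⟩ ⟨φ', hφ'⟩
    exact ⟨φ'.trans φ, hφ.mul hφ'⟩
  one_mem' := ⟨LinearEquiv.refl F W, fun n w => by simp⟩
  inv_mem' := by
    rintro g ⟨φ, hφ⟩
    refine ⟨φ.symm, fun n w => φ.injective ?_⟩
    obtain ⟨x, rfl⟩ := φ.surjective w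
    have h := hφ (MulAut.conjNormal g⁻¹ n) x
    rw [← MulAut.mul_apply, ← map_mul, mul_inv_cancel, map_one, MulAut.one_apply] at h
    simpa using h.symm

theorem mem_inertiaGroup : g ∈ inertiaGroup σ ↔ ∃ φ : W ≃ₗ[F] W, IsTwisted σ g φ := Iff.rfl

theorem le_inertiaGroup : N ≤ inertiaGroup σ := by
  intro n hn
  refine ⟨LinearEquiv.ofLinearMap (σ ⟨n, hn⟩) (σ ⟨n, hn⟩⁻¹) ?_ ?_, isTwisted_coe (⟨n, hn⟩ : N)⟩ <;>
  · ext w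
    simp

theorem IsTwisted.bilinInvariant_compl₁₂ {c : W →ₗ[F] W →ₗ[F] F} (hc : BilinInvariant σ c)
    {φ ψ : W →ₗ[F] W} (hφ : IsTwisted σ g φ) (hψ : IsTwisted σ g ψ) :
    BilinInvariant σ (c.compl₁₂ φ ψ) := by
  intro n w w'
  simp only [LinearMap.compl₁₂_apply]
  rw [hφ, hψ, hc]

/-- An irreducible representation of a normal subgroup of odd index that is paired with
one of its conjugates carries a nonzero invariant form. -/
theorem IsTwistedPairing.exists_bilinInvariant [FiniteDimensional F W] (hσ : IsIrred σ)
    (hodd : Odd N.index) {c : W →ₗ[F] W →ₗ[F] F} (hc : IsTwistedPairing σ g c) (h0 : c ≠ 0) :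
    ∃ B : W →ₗ[F] W →ₗ[F] F, BilinInvariant σ B ∧ B ≠ 0 := by
  have h0' : c.flip ≠ 0 := fun h => h0 (by ext x y; exact LinearMap.congr_fun₂ h y x)
  have hsq : g ^ 2 ∈ inertiaGroup σ := by
    rw [mem_inertiaGroup]
    simpa [pow_two] using hc.exists_isTwisted hσ h0 hc.flip h0'
  have hg : g ∈ inertiaGroup σ := by
    obtain ⟨k, hk⟩ := hodd
    have h := le_inertiaGroup (σ := σ) (N.pow_index_mem g)
    rw [hk, pow_succ, pow_mul] at h
    exact (Subgroup.mul_mem_cancel_left _ (pow_mem hsq k)).1 h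
  obtain ⟨φ, hφ⟩ := hg
  refine ⟨c ∘ₗ φ.toLinearMap, fun n w w' => ?_, fun h => h0 ?_⟩
  · simp only [LinearMap.comp_apply]
    rw [hφ, hc]
  · ext w w'
    have := LinearMap.congr_fun₂ h (φ.symm w) w'
    simpa using this

theorem IsTwisted.eq_of_isometry [CharP F 2] [FiniteDimensional F W] (hσ : IsIrred σ)
    (hs : IsSplitting F ↥N) {B : W →ₗ[F] W →ₗ[F] F} (hB : BilinInvariant σ B) (h0 : B ≠ 0)
    {φ ψ : W →ₗ[F] W} (hφ : IsTwisted σ g φ) (hψ : IsTwisted σ g ψ)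
    (hφB : ∀ w w', B (φ w) (φ w') = B w w') (hψB : ∀ w w', B (ψ w) (ψ w') = B w w') :
    φ = ψ := by
  have hinj := hσ.injective_of_bilinInvariant hB h0
  obtain ⟨c, hc⟩ := hσ.eq_smul_of_bilinInvariant hs hB h0 (hψ.bilinInvariant_compl₁₂ hB hφ)
  have hφinj : Function.Injective φ := by
    refine (injective_iff_map_eq_zero φ).2 fun w hw => hinj ?_
    ext w'
    rw [← hφB, hw]
    simp
  have hφsurj := LinearMap.injective_iff_surjective.1 hφinj
  have hψφ : ψ = c • φ := by
    refine LinearMap.ext fun w => hinj (LinearMap.ext fun w' => ?_)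
    obtain ⟨x, rfl⟩ := hφsurj w'
    have h := LinearMap.congr_fun₂ hc w x
    simpa [hφB] using h
  obtain ⟨w, w', hw⟩ : ∃ w w', B w w' ≠ 0 := by
    by_contra! h
    exact h0 (LinearMap.ext₂ h)
  have hc2 : c ^ 2 = 1 := by
    have h := hψB w w'
    simp only [hψφ, LinearMap.smul_apply, map_smul, hφB, smul_eq_mul, ← mul_assoc] at h
    exact mul_right_cancel₀ hw (by rw [pow_two, h, one_mul])
  rw [hψφ, eq_one_of_sq_eq_one hc2, one_smul]

theorem exists_isTwisted_isometry [CharP F 2] [PerfectField F] [FiniteDimensional F W]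
    (hσ : IsIrred σ) (hs : IsSplitting F ↥N) {B : W →ₗ[F] W →ₗ[F] F}
    (hB : BilinInvariant σ B) (h0 : B ≠ 0) (hg : g ∈ inertiaGroup σ) :
    ∃ φ : W →ₗ[F] W, IsTwisted σ g φ ∧ ∀ w w', B (φ w) (φ w') = B w w' := by
  obtain ⟨φ, hφ⟩ := hg
  obtain ⟨a, ha⟩ := hσ.eq_smul_of_bilinInvariant hs hB h0 (hφ.bilinInvariant_compl₁₂ hB hφ)
  have haB : ∀ w w', B (φ w) (φ w') = a * B w w' := LinearMap.congr_fun₂ ha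
  have ha0 : a ≠ 0 := by
    rintro rfl
    refine h0 (LinearMap.ext₂ fun w w' => ?_)
    simpa using haB (φ.symm w) (φ.symm w')
  obtain ⟨m, rfl⟩ := exists_sq_eq_of_perfectField a
  have hm : m ≠ 0 := by
    rintro rfl
    simp at ha0
  refine ⟨m⁻¹ • φ.toLinearMap, fun n w => ?_, fun w w' => ?_⟩
  · simpa using congrArg (m⁻¹ • ·) (hφ n w)
  · simp only [LinearMap.smul_apply, LinearEquiv.coe_coe, map_smul, haB, smul_eq_mul]
    field_simp

/-- A self-dual irreducible representation in characteristic two extends to its inertia group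
by isometries of the invariant form. -/
theorem exists_extension_isometry [CharP F 2] [PerfectField F] [FiniteDimensional F W]
    (hσ : IsIrred σ) (hs : IsSplitting F ↥N) {B : W →ₗ[F] W →ₗ[F] F}
    (hB : BilinInvariant σ B) (h0 : B ≠ 0) :
    ∃ Φ : Representation F (inertiaGroup σ) W,
      (∀ t : inertiaGroup σ, IsTwisted σ (t : G) (Φ t)) ∧ BilinInvariant Φ B ∧
      ∀ (t : inertiaGroup σ) (n : N), (t : G) = n → Φ t = σ n := by
  choose Φ hΦ hΦB using fun t : inertiaGroup σ => exists_isTwisted_isometry hσ hs hB h0 t.2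
  have key : ∀ (t : inertiaGroup σ) (n : N), (t : G) = n → Φ t = σ n := fun t n htn =>
    IsTwisted.eq_of_isometry hσ hs hB h0 (hΦ t) (htn ▸ isTwisted_coe n) (hΦB t) (hB n)
  refine ⟨⟨⟨Φ, ?_⟩, ?_⟩, hΦ, hΦB, key⟩
  · simpa using key 1 1 rfl
  · intro t t'
    refine IsTwisted.eq_of_isometry hσ hs hB h0 (hΦ _) ((hΦ t).mul (hΦ t')) (hΦB _) ?_
    simp [hΦB]

end Twisted

section Restriction

variable {F : Type} [Field F] {G : Type} [Group G] {N : Subgroup G}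
variable {V W : Type} [AddCommGroup V] [Module F V] [AddCommGroup W] [Module F W]
variable {ρ : Representation F G V} {σ : Representation F ↥N W}

theorem IsSelfDual.exists_bilinInvariant (h : IsSelfDual ρ) :
    ∃ b : V →ₗ[F] V →ₗ[F] F, Function.Injective b ∧ BilinInvariant ρ b := by
  obtain ⟨e, he⟩ := h
  refine ⟨e.toLinearMap, e.injective, fun g v w => ?_⟩
  have h := LinearMap.congr_fun (he g v) (ρ g w)
  simpa [Representation.dual_apply, Dual.transpose_apply] using h

theorem equivHom_restrict_apply (f : EquivHom σ (ρ.comp N.subtype)) (n : N) (w : W) :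
    f.1 (σ n w) = ρ n (f.1 w) :=
  f.2 n w

variable {b : V →ₗ[F] V →ₗ[F] F}

theorem eq_zero_of_forall_pairing_eq_zero (hρ : IsIrred ρ) (hinj : Function.Injective b)
    {h k : EquivHom σ (ρ.comp N.subtype)} (hk : k ≠ 0)
    (hz : ∀ (g : G) (w w' : W), b (h.1 w) (ρ g (k.1 w')) = 0) : h = 0 := by
  let X : Submodule F V :=
    { carrier := {v | ∀ (g : G) (w : W), b (h.1 w) (ρ g v) = 0}
      add_mem' := by
        intro v v' hv hv' g w
        rw [map_add, map_add, hv, hv', add_zero]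
      zero_mem' := by simp
      smul_mem' := by
        intro a v hv g w
        rw [map_smul, map_smul, hv, smul_zero] }
  have hX : X = ⊤ := by
    refine (hρ.2 X fun g v hv g' w => ?_).resolve_left fun hbot => hk ?_
    · rw [← Module.End.mul_apply, ← map_mul]
      exact hv _ w
    · ext w'
      have : k.1 w' ∈ X := fun g w => hz g w w'
      rw [hbot] at this
      simpa using this
  ext w
  refine hinj (LinearMap.ext fun v => ?_)
  have hv : v ∈ X := hX ▸ Submodule.mem_top
  simpa using hv 1 w

variable [N.Normal]

/-- The action of a group `T` to which `σ` extends on the space of homomorphisms from `σ`. -/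
def homRep {T : Subgroup G} (ρ : Representation F G V) (Φ : Representation F T W)
    (hΦ : ∀ t : T, IsTwisted σ (t : G) (Φ t)) :
    Representation F T (EquivHom σ (ρ.comp N.subtype)) where
  toFun t :=
    { toFun := fun f => ⟨ρ t ∘ₗ f.1 ∘ₗ Φ t⁻¹, by
        intro n w
        simp only [LinearMap.comp_apply]
        rw [hΦ t⁻¹ n w, equivHom_restrict_apply]
        simp only [MonoidHom.comp_apply, Subgroup.coe_subtype, ← Module.End.mul_apply, ← map_mul]
        simp [mul_assoc]⟩
      map_add' := fun f f' => by
        ext w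
        simp
      map_smul' := fun a f => by
        ext w
        simp }
  map_one' := by
    ext f w
    simp
  map_mul' t t' := by
    ext f w
    simp

theorem homRep_apply {T : Subgroup G} {Φ : Representation F T W}
    {hΦ : ∀ t : T, IsTwisted σ (t : G) (Φ t)} (t : T)
    (f : EquivHom σ (ρ.comp N.subtype)) (w : W) :
    (homRep ρ Φ hΦ t f).1 w = ρ t (f.1 (Φ t⁻¹ w)) := rfl

theorem homRep_apply_apply {T : Subgroup G} {Φ : Representation F T W}
    {hΦ : ∀ t : T, IsTwisted σ (t : G) (Φ t)} (t : T)
    (f : EquivHom σ (ρ.comp N.subtype)) (w : W) :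
    (homRep ρ Φ hΦ t f).1 (Φ t w) = ρ t (f.1 w) := by
  rw [homRep_apply, Representation.inv_self_apply]

theorem isTwistedPairing_compl₁₂ (hb : BilinInvariant ρ b)
    (f k : EquivHom σ (ρ.comp N.subtype)) (g : G) :
    IsTwistedPairing σ g (b.compl₁₂ f.1 (ρ g ∘ₗ k.1)) := by
  intro n w w'
  simp only [LinearMap.compl₁₂_apply, LinearMap.comp_apply, equivHom_restrict_apply]
  have h : ρ g (ρ n (k.1 w')) = ρ (MulAut.conjNormal g n : N) (ρ g (k.1 w')) := by
    simp only [← Module.End.mul_apply, ← map_mul]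
    simp [MulAut.conjNormal_apply]
  rw [h, hb]

theorem BilinInvariant.homRep {T : Subgroup G} {Φ : Representation F T W}
    {hΦ : ∀ t : T, IsTwisted σ (t : G) (Φ t)} {B : W →ₗ[F] W →ₗ[F] F} (hΦB : BilinInvariant Φ B)
    (hb : BilinInvariant ρ b) (hB : B ≠ 0)
    {β : EquivHom σ (ρ.comp N.subtype) →ₗ[F] EquivHom σ (ρ.comp N.subtype) →ₗ[F] F}
    (hβ : ∀ f k w w', b (f.1 w) (k.1 w') = β f k * B w w') :
    BilinInvariant (homRep ρ Φ hΦ) β := by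
  intro t f k
  obtain ⟨w, w', hw⟩ : ∃ w w', B w w' ≠ 0 := by
    by_contra! h
    exact hB (LinearMap.ext₂ h)
  refine mul_right_cancel₀ hw ?_
  rw [← hβ f k, ← hΦB t w w', ← hβ, homRep_apply_apply, homRep_apply_apply, hb]

theorem exists_form_equivHom [FiniteDimensional F W] (hσ : IsIrred σ) (hs : IsSplitting F ↥N)
    {B : W →ₗ[F] W →ₗ[F] F} (hB : BilinInvariant σ B) (h0 : B ≠ 0) (hb : BilinInvariant ρ b) :
    ∃ β : EquivHom σ (ρ.comp N.subtype) →ₗ[F] EquivHom σ (ρ.comp N.subtype) →ₗ[F] F,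
      ∀ f k w w', b (f.1 w) (k.1 w') = β f k * B w w' := by
  obtain ⟨w₀, w₁, hw⟩ : ∃ w w', B w w' ≠ 0 := by
    by_contra! h
    exact h0 (LinearMap.ext₂ h)
  let ev (w : W) : EquivHom σ (ρ.comp N.subtype) →ₗ[F] V :=
    LinearMap.applyₗ w ∘ₗ Submodule.subtype _
  refine ⟨(B w₀ w₁)⁻¹ • b.compl₁₂ (ev w₀) (ev w₁), fun f k w w' => ?_⟩
  obtain ⟨a, ha⟩ := hσ.eq_smul_of_bilinInvariant hs hB h0 (γ := b.compl₁₂ f.1 k.1) (by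
    simpa [isTwistedPairing_one_iff, Module.End.one_eq_id] using isTwistedPairing_compl₁₂ hb f k 1)
  have haB : ∀ w w', b (f.1 w) (k.1 w') = a * B w w' := LinearMap.congr_fun₂ ha
  simp only [ev, LinearMap.smul_apply, LinearMap.compl₁₂_apply, LinearMap.comp_apply,
    LinearMap.applyₗ_apply_apply, Submodule.subtype_apply, haB, smul_eq_mul]
  field_simp

variable [FiniteDimensional F W]

theorem eq_zero_of_orthogonal_subrep (hρ : IsIrred ρ) (hσ : IsIrred σ)
    {Φ : Representation F (inertiaGroup σ) W}
    {hΦ : ∀ t : inertiaGroup σ, IsTwisted σ (t : G) (Φ t)} {B : W →ₗ[F] W →ₗ[F] F}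
    (hB : BilinInvariant σ B) (h0 : B ≠ 0) (hinj : Function.Injective b)
    (hb : BilinInvariant ρ b)
    {β : EquivHom σ (ρ.comp N.subtype) →ₗ[F] EquivHom σ (ρ.comp N.subtype) →ₗ[F] F}
    (hβ : ∀ f k w w', b (f.1 w) (k.1 w') = β f k * B w w')
    {K : Submodule F (EquivHom σ (ρ.comp N.subtype))} (hK : IsSubrep (homRep ρ Φ hΦ) K)
    (hbot : K ≠ ⊥) {h : EquivHom σ (ρ.comp N.subtype)} (hx : ∀ x ∈ K, β h x = 0) : h = 0 := by
  obtain ⟨k, hkK, hk⟩ := K.ne_bot_iff.1 hbot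
  refine eq_zero_of_forall_pairing_eq_zero hρ hinj hk fun g w w' => ?_
  by_cases hg : g ∈ inertiaGroup σ
  · have hgk := homRep_apply_apply (ρ := ρ) (hΦ := hΦ) ⟨g, hg⟩ k w'
    simp only at hgk
    rw [← hgk, hβ, hx _ (hK _ _ hkK), zero_mul]
  · by_contra hne0
    refine hg (mem_inertiaGroup.2 ?_)
    have := (isTwistedPairing_compl₁₂ hb h k g).exists_isTwisted hσ
      (fun hz => hne0 (LinearMap.congr_fun₂ hz w w')) (isTwistedPairing_one_iff.2 hB) h0
    simpa using this

/-- The space of homomorphisms from `σ` is an irreducible representation of the inertia group. -/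
theorem isIrred_homRep [FiniteDimensional F V] (hρ : IsIrred ρ) (hσ : IsIrred σ) {Φ : Representation F (inertiaGroup σ) W}
    {hΦ : ∀ t : inertiaGroup σ, IsTwisted σ (t : G) (Φ t)} {B : W →ₗ[F] W →ₗ[F] F}
    (hB : BilinInvariant σ B) (h0 : B ≠ 0) (hinj : Function.Injective b)
    (hb : BilinInvariant ρ b) (hne : EquivHom σ (ρ.comp N.subtype) ≠ ⊥)
    {β : EquivHom σ (ρ.comp N.subtype) →ₗ[F] EquivHom σ (ρ.comp N.subtype) →ₗ[F] F}
    (hβ : ∀ f k w w', b (f.1 w) (k.1 w') = β f k * B w w') :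
    IsIrred (homRep ρ Φ hΦ) := by
  refine ⟨Submodule.nontrivial_iff_ne_bot.2 hne, fun K hK => or_iff_not_imp_left.2 fun hbot => ?_⟩
  let r : EquivHom σ (ρ.comp N.subtype) →ₗ[F] Dual F K := β.compl₂ K.subtype
  have hr : Function.Injective r := (injective_iff_map_eq_zero r).2 fun h hh =>
    eq_zero_of_orthogonal_subrep hρ hσ hB h0 hinj hb hβ hK hbot fun x hx => LinearMap.congr_fun hh ⟨x, hx⟩
  have hle := LinearMap.finrank_le_finrank_of_injective hr
  exact Submodule.eq_top_of_finrank_eq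
    (le_antisymm K.finrank_le (hle.trans_eq (Subspace.dual_finrank_eq (K := F) (V := K))))

theorem IsIrred.isSelfDual_of_bilinInvariant {H : Type} [Group H] {τ : Representation F H W}
    (hτ : IsIrred τ) {B : W →ₗ[F] W →ₗ[F] F} (hB : BilinInvariant τ B) (h0 : B ≠ 0) :
    IsSelfDual τ := by
  refine ⟨LinearMap.linearEquivOfInjective B (hτ.injective_of_bilinInvariant hB h0)
    Subspace.dual_finrank_eq.symm, fun g v => LinearMap.ext fun w => ?_⟩
  have h := hB g v (τ g⁻¹ w)
  rw [Representation.self_inv_apply] at h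
  simpa [Representation.dual_apply, Dual.transpose_apply] using h

end Restriction

/-- |G:N| odd; the restriction to N of a self-dual irreducible FG-module is
multiplicity-free with all constituents self-dual. -/
theorem stmt_8 {F : Type} [Field F] [CharP F 2] [PerfectField F]
    {G : Type} [Group G] [Finite G] (N : Subgroup G) [N.Normal]
    (hodd : Odd N.index) (hsplit : ∀ H : Subgroup G, IsSplitting F ↥H)
    {V : Type} [AddCommGroup V] [Module F V] [FiniteDimensional F V]
    (ρ : Representation F G V) (hirr : IsIrred ρ) (hsd : IsSelfDual ρ) :
    ∀ (W : Type) [AddCommGroup W] [Module F W] (σ : Representation F ↥N W),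
      FiniteDimensional F W → IsIrred σ →
      EquivHom σ (ρ.comp N.subtype) ≠ ⊥ →
      repMult σ (ρ.comp N.subtype) = 1 ∧ IsSelfDual σ := by
  intro W _ _ σ _ hσ hne
  have hsN := hsplit N
  obtain ⟨b, hinj, hb⟩ := hsd.exists_bilinInvariant
  obtain ⟨f, hf, hf0⟩ := Submodule.ne_bot_iff _ |>.1 hne
  obtain ⟨B, hB, h0⟩ : ∃ B : W →ₗ[F] W →ₗ[F] F, BilinInvariant σ B ∧ B ≠ 0 := by
    have hf0' : (⟨f, hf⟩ : EquivHom σ (ρ.comp N.subtype)) ≠ 0 := by simpa using hf0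
    obtain ⟨g, w, w', hg⟩ : ∃ (g : G) (w w' : W), b (f w) (ρ g (f w')) ≠ 0 := by
      by_contra! h
      exact hf0' (eq_zero_of_forall_pairing_eq_zero hirr hinj hf0' h)
    exact (isTwistedPairing_compl₁₂ hb ⟨f, hf⟩ ⟨f, hf⟩ g).exists_bilinInvariant hσ hodd
      fun hz => hg (LinearMap.congr_fun₂ hz w w')
  refine ⟨?_, hσ.isSelfDual_of_bilinInvariant hB h0⟩
  obtain ⟨Φ, hΦ, hΦB, hΦN⟩ := exists_extension_isometry hσ hsN hB h0
  obtain ⟨β, hβ⟩ := exists_form_equivHom hσ hsN hB h0 hb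
  have hβ0 : β ≠ 0 := by
    have := Submodule.nontrivial_iff_ne_bot.2 hne
    rintro rfl
    exact hf0 (congrArg Subtype.val (eq_zero_of_orthogonal_subrep (hΦ := hΦ) (K := ⊤)
      (h := ⟨f, hf⟩) hirr hσ hB h0 hinj hb hβ (fun _ _ _ => Submodule.mem_top)
      top_ne_bot fun _ _ => rfl))
  refine (isIrred_homRep (hΦ := hΦ) hirr hσ hB h0 hinj hb hne hβ).finrank_eq_one_of_odd_index
    (L := N.subgroupOf (inertiaGroup σ)) ?_ (hsplit _) ?_ (hΦB.homRep hb h0 hβ) hβ0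
  · exact hodd.of_dvd_nat (N.relIndex_dvd_index_of_normal _)
  · intro t ht
    ext k w
    rw [Subgroup.mem_subgroupOf] at ht
    have hn : Φ t = σ ⟨t, ht⟩ := hΦN t ⟨t, ht⟩ rfl
    obtain ⟨x, rfl⟩ : ∃ x, Φ t x = w := ⟨_, Representation.self_inv_apply Φ t w⟩
    rw [homRep_apply_apply, Module.End.one_apply, hn, equivHom_restrict_apply]
end

section
/- Let G be a finite group, N a normal subgroup, F a perfect splitting field of characteristic 2, and W a self-dual irreducible FN-module. Then there is exactly one self-dual irreducible FG-module V such that W occurs with odd multiplicity in V↓_N; moreover for this V the multiplicity of W in V↓_N equals 1. -/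
open Module

/-- A finite-dimensional space with a nondegenerate alternating form has even dimension. -/
theorem even_finrank_of_isAltForm {F : Type} [Field F] :
    ∀ (n : ℕ) {M : Type} [AddCommGroup M] [Module F M] [FiniteDimensional F M]
      (B : M →ₗ[F] M →ₗ[F] F), Nondeg B → IsAltForm B → finrank F M = n → Even n := by
  intro n
  induction n using Nat.strong_induction_on with
  | _ n ih =>
  intro M _ _ _ B hB halt hn
  rcases Nat.eq_zero_or_pos n with rfl | hpos
  · exact Even.zero
  have hskew : ∀ x y, B x y = -B y x := fun x y => by
    have := halt (x + y)
    simp only [map_add, LinearMap.add_apply, halt x, halt y] at this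
    linear_combination this
  have : Nontrivial M := Module.nontrivial_of_finrank_pos (R := F) (by omega)
  obtain ⟨v, hv⟩ := exists_ne (0 : M)
  obtain ⟨w, hw⟩ : ∃ w, B v w ≠ 0 := by
    by_contra! h
    exact hv (hB v h)
  let p : M →ₗ[F] F × F := (B v).prod (B w)
  have hp : LinearMap.range p = ⊤ := by
    rw [LinearMap.range_eq_top]
    rintro ⟨a, b⟩
    refine ⟨(a / B v w) • w - (b / B v w) • v, ?_⟩
    have hvv := halt v
    have hww := halt w
    ext
    · simp [p, hvv, hw]
    · simp [p, hww, hskew w v, hw]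
  have hrank := p.finrank_range_add_finrank_ker
  rw [hp, finrank_top, Module.finrank_prod, Module.finrank_self, hn] at hrank
  have hker : ∀ x, x ∈ LinearMap.ker p ↔ B v x = 0 ∧ B w x = 0 := fun x => by
    simp [p]
  have heven := ih (finrank F (LinearMap.ker p)) (by omega)
    (B.domRestrict₁₂ (LinearMap.ker p) (LinearMap.ker p)) ?_ (fun x => halt x.1) rfl
  · rw [← hrank, add_comm]
    exact heven.add (by norm_num)
  · rintro ⟨x, hx⟩ h
    obtain ⟨hvx, hwx⟩ := (hker x).1 hx
    ext
    refine hB x fun z => ?_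
    have hz : z - (B v z / B v w) • w + (B w z / B v w) • v ∈ LinearMap.ker p := by
      rw [hker]
      have h1 := hskew w v
      simp only [map_sub, map_add, map_smul, smul_eq_mul, halt v, halt w, h1]
      constructor <;> field_simp <;> ring
    have hxz : B x (z - (B v z / B v w) • w + (B w z / B v w) • v) = 0 := h ⟨_, hz⟩
    simpa [hskew x v, hskew x w, hvx, hwx] using hxz

/-- In characteristic two, a self-dual irreducible representation carries a nondegenerate
invariant symmetric form. -/
theorem exists_symm_invariant_form {F : Type} [Field F] [CharP F 2] {G : Type} [Group G]
    {V : Type} [AddCommGroup V] [Module F V] (ρ : Representation F G V)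
    (hirr : IsIrred ρ) (hsd : IsSelfDual ρ) :
    ∃ B : V →ₗ[F] V →ₗ[F] F, BilinInvariant ρ B ∧ Nondeg B ∧ ∀ v w, B v w = B w v := by
  obtain ⟨e, he⟩ := hsd
  let B : V →ₗ[F] V →ₗ[F] F := e.toLinearMap
  have hBe : ∀ v, B v = e v := fun v => rfl
  have hinv : BilinInvariant ρ B := fun g v w => by
    rw [hBe, he, Representation.dual_apply]
    simp [Module.Dual.transpose_apply, ← Module.End.mul_apply, ← map_mul, hBe]
  by_cases hC : B + B.flip = 0
  · refine ⟨B, hinv, fun v hv => ?_, fun v w => ?_⟩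
    · exact e.map_eq_zero_iff.1 (LinearMap.ext hv)
    · have := congrArg (fun D : V →ₗ[F] V →ₗ[F] F => D v w) hC
      simpa [CharTwo.add_eq_zero] using this
  · have hCinv : BilinInvariant ρ (B + B.flip) := fun g v w => by simp [hinv g v w, hinv g w v]
    refine ⟨B + B.flip, hCinv, ?_, fun v w => by simp [add_comm]⟩
    have hsub : IsSubrep ρ (LinearMap.ker (B + B.flip)) := fun g v hv => by
      rw [LinearMap.mem_ker] at hv ⊢
      ext w
      have := hCinv g v (ρ g⁻¹ w)
      rw [hv, ← Module.End.mul_apply, ← map_mul] at this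
      simpa using this
    rcases hirr.2 _ hsub with h | h
    · intro v hv
      have : v ∈ LinearMap.ker (B + B.flip) := LinearMap.mem_ker.2 (LinearMap.ext hv)
      simpa [h] using this
    · exact absurd (LinearMap.ker_eq_top.1 h) hC

/-- A nondegenerate form on a finite-dimensional space identifies it with its dual. -/
theorem exists_equiv_of_nondeg {F : Type} [Field F] {W : Type} [AddCommGroup W] [Module F W]
    [FiniteDimensional F W] {B : W →ₗ[F] W →ₗ[F] F} (hB : Nondeg B) :
    ∃ b : W ≃ₗ[F] Module.Dual F W, ∀ v w, b v w = B v w := by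
  have hinj : Function.Injective B := by
    rw [injective_iff_map_eq_zero]
    exact fun v hv => hB v fun w => by simp [hv]
  exact ⟨LinearMap.linearEquivOfInjective B hinj Subspace.dual_finrank_eq.symm, fun v w => rfl⟩

/-- If all endomorphisms are scalar, invariant forms are unique up to scalars. -/
theorem form_eq_smul {F : Type} [Field F] {G : Type} [Group G] {W : Type} [AddCommGroup W]
    [Module F W] [FiniteDimensional F W] {σ : Representation F G W}
    (hschur : ∀ f ∈ EquivHom σ σ, ∃ c : F, f = c • (LinearMap.id : W →ₗ[F] W))
    {B C : W →ₗ[F] W →ₗ[F] F} (hB : Nondeg B) (hBinv : BilinInvariant σ B)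
    (hCinv : BilinInvariant σ C) : ∃ c : F, ∀ v w, C v w = c * B v w := by
  obtain ⟨b, hb⟩ := exists_equiv_of_nondeg hB
  have hbC : ∀ v w, B (b.symm (C v)) w = C v w := fun v w => by rw [← hb]; simp
  have key : ∀ (D : W →ₗ[F] W →ₗ[F] F), BilinInvariant σ D → ∀ g v w,
      D (σ g v) w = D v (σ g⁻¹ w) := fun D hD g v w => by
    rw [← hD g v (σ g⁻¹ w), ← Module.End.mul_apply, ← map_mul]
    simp
  obtain ⟨c, hc⟩ := hschur (b.symm.toLinearMap ∘ₗ C) fun g v => by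
    apply b.injective
    ext w
    simp only [LinearMap.comp_apply, LinearEquiv.coe_coe, b.apply_symm_apply]
    rw [key C hCinv, hb, key B hBinv, hbC]
  refine ⟨c, fun v w => ?_⟩
  have := congrArg (fun f : W →ₗ[F] W => f v) hc
  simp only [LinearMap.comp_apply, LinearEquiv.coe_coe, LinearMap.smul_apply,
    LinearMap.id_apply] at this
  rw [← hbC, this]
  simp

theorem exists_sq_eq_of_perfect {F : Type} [Field F] [CharP F 2] [PerfectField F] (c : F) :
    ∃ d : F, d ^ 2 = c := by
  have : ExpChar F 2 := ExpChar.prime Nat.prime_two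
  exact surjective_frobenius F 2 c

theorem sq_injective_of_charP_two {F : Type} [Field F] [CharP F 2] :
    Function.Injective fun c : F => c ^ 2 := by
  have : ExpChar F 2 := ExpChar.prime Nat.prime_two
  exact frobenius_inj F 2

/-- A nonzero intertwiner out of an irreducible representation is injective. -/
theorem injective_of_irred {F : Type} [Field F] {G : Type} [Group G] {V W : Type}
    [AddCommGroup V] [Module F V] [AddCommGroup W] [Module F W] {ρ : Representation F G V}
    (hirr : IsIrred ρ) {f : V →ₗ[F] W} (τ : G → W →ₗ[F] W)
    (hf : ∀ g v, f (ρ g v) = τ g (f v)) (h0 : f ≠ 0) : Function.Injective f := by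
  rw [← LinearMap.ker_eq_bot]
  refine (hirr.2 (LinearMap.ker f) fun g v hv => ?_).resolve_right
    fun h => h0 (LinearMap.ker_eq_top.1 h)
  rw [LinearMap.mem_ker] at hv ⊢
  rw [hf, hv, map_zero]

/-- A nonzero intertwiner into an irreducible representation is surjective. -/
theorem surjective_of_irred {F : Type} [Field F] {G : Type} [Group G] {V W : Type}
    [AddCommGroup V] [Module F V] [AddCommGroup W] [Module F W] {ρ : Representation F G V}
    {τ : Representation F G W} (hirr : IsIrred τ) {f : V →ₗ[F] W}
    (hf : f ∈ EquivHom ρ τ) (h0 : f ≠ 0) : Function.Surjective f := by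
  rw [← LinearMap.range_eq_top]
  refine (hirr.2 (LinearMap.range f) ?_).resolve_left fun h => h0 (LinearMap.range_eq_bot.1 h)
  rintro g _ ⟨v, rfl⟩
  exact ⟨ρ g v, hf g v⟩

theorem repMult_eq_one {F : Type} [Field F] {G : Type} [Group G] {V W : Type}
    [AddCommGroup V] [Module F V] [AddCommGroup W] [Module F W] {σ : Representation F G W}
    {ρ : Representation F G V} {e : W →ₗ[F] V} (he : e ∈ EquivHom σ ρ) (he0 : e ≠ 0)
    (h : ∀ a ∈ EquivHom σ ρ, ∃ c : F, c • e = a) : repMult σ ρ = 1 :=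
  finrank_eq_one_iff'.2 ⟨(⟨e, he⟩ : EquivHom σ ρ), fun h0 => he0 (congrArg Subtype.val h0),
    fun a => (h a.1 a.2).imp fun _ hc => Subtype.ext hc⟩

section IsometricConj

variable {F : Type} [Field F] {G : Type} [Group G] {N : Subgroup G} [N.Normal]
  {W : Type} [AddCommGroup W] [Module F W]

/-- `f` is an isometry of `B` that carries `σ` to its conjugate by `t`. -/
def IsometricConj (σ : Representation F ↥N W) (B : W →ₗ[F] W →ₗ[F] F) (t : G)
    (f : W ≃ₗ[F] W) : Prop :=
  (∀ (n : N) (w : W), f (σ n w) = σ (MulAut.conjNormal t n) (f w)) ∧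
    ∀ w w' : W, B (f w) (f w') = B w w'

variable {σ : Representation F ↥N W} {B : W →ₗ[F] W →ₗ[F] F}

theorem IsometricConj.one : IsometricConj σ B 1 (LinearEquiv.refl F W) :=
  ⟨fun n w => by simp, fun w w' => by simp⟩

theorem IsometricConj.mul {s t : G} {f g : W ≃ₗ[F] W} (hf : IsometricConj σ B s f)
    (hg : IsometricConj σ B t g) : IsometricConj σ B (s * t) (g.trans f) :=
  ⟨fun n w => by simp [hf.1, hg.1], fun w w' => by simp [hf.2, hg.2]⟩

theorem IsometricConj.inv {t : G} {f : W ≃ₗ[F] W} (hf : IsometricConj σ B t f) :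
    IsometricConj σ B t⁻¹ f.symm := by
  refine ⟨fun n w => f.injective ?_, fun w w' => ?_⟩
  · rw [hf.1, ← MulAut.mul_apply, ← map_mul]
    simp
  · rw [← hf.2]
    simp

theorem IsometricConj.exists_coe (hinv : BilinInvariant σ B) (n : N) :
    ∃ f : W ≃ₗ[F] W, IsometricConj σ B (n : G) f ∧ ∀ w, f w = σ n w := by
  refine ⟨LinearEquiv.ofLinearMap (σ n) (σ n⁻¹) ?_ ?_, ⟨fun m w => ?_, fun w w' => hinv n w w'⟩,
    fun w => rfl⟩
  · rw [← Module.End.mul_eq_comp, ← map_mul]; simp; rfl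
  · rw [← Module.End.mul_eq_comp, ← map_mul]; simp; rfl
  · change σ n (σ m w) = σ _ (σ n w)
    rw [← Module.End.mul_apply, ← Module.End.mul_apply, ← map_mul, ← map_mul]
    congr 2
    ext
    simp [MulAut.conjNormal_apply]

theorem IsometricConj.unique [CharP F 2] (hirr : IsIrred σ)
    (hschur : ∀ f ∈ EquivHom σ σ, ∃ c : F, f = c • (LinearMap.id : W →ₗ[F] W))
    (hB : Nondeg B) {t : G} {f g : W ≃ₗ[F] W} (hf : IsometricConj σ B t f)
    (hg : IsometricConj σ B t g) : f = g := by
  have h := hf.inv.mul hg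
  rw [inv_mul_cancel] at h
  obtain ⟨c, hc⟩ := hschur (g.trans f.symm).toLinearMap fun n w => by
    simpa using h.1 n w
  have hc' : ∀ w, f.symm (g w) = c • w := fun w => by
    simpa using congrArg (fun k : W →ₗ[F] W => k w) hc
  have := hirr.1
  obtain ⟨v, hv⟩ := exists_ne (0 : W)
  obtain ⟨w, hw⟩ : ∃ w, B v w ≠ 0 := by
    by_contra! h
    exact hv (hB v h)
  have h2 := h.2 v w
  simp only [LinearEquiv.trans_apply, hc', map_smul, LinearMap.smul_apply, smul_eq_mul] at h2
  have hc1 : c = 1 :=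
    sq_injective_of_charP_two (mul_right_cancel₀ hw (by linear_combination h2))
  ext w
  have := hc' w
  rw [hc1, one_smul, LinearEquiv.symm_apply_eq] at this
  exact this.symm

/-- Over a perfect field of characteristic two, an intertwiner with a conjugate can be rescaled
to an isometry. -/
theorem IsometricConj.exists_of_ne_zero [CharP F 2] [PerfectField F] [FiniteDimensional F W]
    (hirr : IsIrred σ)
    (hschur : ∀ f ∈ EquivHom σ σ, ∃ c : F, f = c • (LinearMap.id : W →ₗ[F] W))
    (hB : Nondeg B) (hinv : BilinInvariant σ B) {t : G} {a : W →ₗ[F] W} (h0 : a ≠ 0)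
    (ha : ∀ (n : N) (w : W), a (σ n w) = σ (MulAut.conjNormal t n) (a w)) :
    ∃ f, IsometricConj σ B t f := by
  have hinj : Function.Injective a :=
    injective_of_irred hirr (fun n => σ (MulAut.conjNormal t n)) ha h0
  let b : W ≃ₗ[F] W := LinearEquiv.ofInjectiveEndo a hinj
  have hb : ∀ w, b w = a w := fun w => rfl
  obtain ⟨c, hc⟩ := form_eq_smul (C := B.compl₁₂ a a) hschur hB hinv fun n v w => by
    simp only [LinearMap.compl₁₂_apply, ha]
    exact hinv _ _ _
  simp only [LinearMap.compl₁₂_apply] at hc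
  have := hirr.1
  obtain ⟨v, hv⟩ := exists_ne (0 : W)
  have hc0 : c ≠ 0 := by
    rintro rfl
    refine (b.map_ne_zero_iff.2 hv) (hB _ fun w => ?_)
    have := hc v (b.symm w)
    rw [← hb, ← hb] at this
    simpa using this
  obtain ⟨d, hd⟩ := exists_sq_eq_of_perfect c
  have hd0 : d ≠ 0 := by
    rintro rfl
    exact hc0 (by simpa using hd.symm)
  refine ⟨b.trans (LinearEquiv.smulOfNeZero F W d⁻¹ (inv_ne_zero hd0)), fun n w => ?_,
    fun w w' => ?_⟩
  · simp [hb, ha]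
  · simp only [LinearEquiv.trans_apply, LinearEquiv.smulOfNeZero_apply, hb, map_smul,
      LinearMap.smul_apply, smul_eq_mul, hc, ← hd]
    field_simp

end IsometricConj

section Coinduced

variable {F : Type} [Field F] {G : Type} [Group G] {N : Subgroup G} [N.Normal]
  {W : Type} [AddCommGroup W] [Module F W]

/-- The underlying space of the representation of `G` coinduced from the canonical extension of
`σ` to its inertia group. -/
def coindSpace (σ : Representation F ↥N W) (B : W →ₗ[F] W →ₗ[F] F) : Submodule F (G → W) where
  carrier := {h | ∀ t f, IsometricConj σ B t f → ∀ x, f (h (x * t)) = h x}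
  add_mem' := fun ha hb t f hf x => by simp [ha t f hf x, hb t f hf x]
  zero_mem' := fun t f hf x => by simp
  smul_mem' := fun c h hh t f hf x => by simp [hh t f hf x]

/-- `G` acts on the coinduced space by left translation. -/
def coindRep (σ : Representation F ↥N W) (B : W →ₗ[F] W →ₗ[F] F) :
    Representation F G (coindSpace σ B) where
  toFun g :=
    { toFun := fun h => ⟨fun x => h.1 (g⁻¹ * x), fun t f hf x => by
        change f (h.1 (g⁻¹ * (x * t))) = h.1 (g⁻¹ * x)
        rw [← mul_assoc]
        exact h.2 t f hf _⟩
      map_add' := fun _ _ => rfl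
      map_smul' := fun _ _ => rfl }
  map_one' := by ext; simp
  map_mul' g g' := by ext; simp [mul_assoc]

variable {σ : Representation F ↥N W} {B : W →ₗ[F] W →ₗ[F] F}

theorem coindRep_apply (g : G) (h : coindSpace σ B) (x : G) :
    (coindRep σ B g h).1 x = h.1 (g⁻¹ * x) := rfl

theorem coindRep_coe_apply (hinv : BilinInvariant σ B) (n : N) (h : coindSpace σ B) (x : G) :
    (coindRep σ B n h).1 x = σ (MulAut.conjNormal x⁻¹ n) (h.1 x) := by
  obtain ⟨f, hf, hfσ⟩ := IsometricConj.exists_coe hinv (MulAut.conjNormal x⁻¹ n)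
  rw [coindRep_apply, ← hfσ, ← h.2 _ f hf]
  congr 2
  simp [mul_assoc]

/-- Values of an `N`-intertwiner from `σ` to the coinduced space are supported on the inertia
group. -/
theorem exists_isometricConj_of_eval_ne_zero [CharP F 2] [PerfectField F] [FiniteDimensional F W]
    (hirr : IsIrred σ)
    (hschur : ∀ f ∈ EquivHom σ σ, ∃ c : F, f = c • (LinearMap.id : W →ₗ[F] W))
    (hB : Nondeg B) (hinv : BilinInvariant σ B) {a : W →ₗ[F] coindSpace σ B}
    (ha : a ∈ EquivHom σ ((coindRep σ B).comp N.subtype)) {w : W} {x : G}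
    (hx : (a w).1 x ≠ 0) : ∃ f, IsometricConj σ B x f := by
  let e : W →ₗ[F] W := LinearMap.proj x ∘ₗ (coindSpace σ B).subtype ∘ₗ a
  have he : ∀ w, e w = (a w).1 x := fun w => rfl
  obtain ⟨f, hf⟩ := IsometricConj.exists_of_ne_zero (t := x⁻¹) (a := e) hirr hschur hB hinv
    (fun h => hx (by rw [← he, h, LinearMap.zero_apply])) fun n w => by
      rw [he, he, ha n w]
      exact coindRep_coe_apply hinv n _ x
  exact ⟨f.symm, by simpa using hf.inv⟩

theorem exists_coindIncl [CharP F 2] (hirr : IsIrred σ)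
    (hschur : ∀ f ∈ EquivHom σ σ, ∃ c : F, f = c • (LinearMap.id : W →ₗ[F] W))
    (hB : Nondeg B) : ∃ e : W →ₗ[F] coindSpace σ B,
      (∀ t f, IsometricConj σ B t f → ∀ w, (e w).1 t = f.symm w) ∧
      ∀ x, (¬ ∃ f, IsometricConj σ B x f) → ∀ w, (e w).1 x = 0 := by
  classical
  let k : G → W →ₗ[F] W := fun x =>
    if hx : ∃ f, IsometricConj σ B x f then hx.choose.symm.toLinearMap else 0
  have hk : ∀ t f, IsometricConj σ B t f → ∀ w, k t w = f.symm w := fun t f hf w => by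
    have hx : ∃ f, IsometricConj σ B t f := ⟨f, hf⟩
    simp only [k, dif_pos hx]
    rw [IsometricConj.unique hirr hschur hB hx.choose_spec hf]
    rfl
  have hk0 : ∀ x, (¬ ∃ f, IsometricConj σ B x f) → ∀ w, k x w = 0 := fun x hx w => by
    simp only [k, dif_neg hx, LinearMap.zero_apply]
  refine ⟨LinearMap.codRestrict _ (LinearMap.pi k) fun w t f hf x => ?_, hk, hk0⟩
  change f (k (x * t) w) = k x w
  by_cases hx : ∃ f, IsometricConj σ B x f
  · obtain ⟨g, hg⟩ := hx
    rw [hk _ _ hg, hk _ _ (hg.mul hf)]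
    simp
  · rw [hk0 x hx, hk0, map_zero]
    rintro ⟨g, hg⟩
    exact hx ⟨_, by simpa using hg.mul hf.inv⟩

/-- An element supported on the inertia group is determined by its value at `1`. -/
theorem eq_coindIncl {e : W →ₗ[F] coindSpace σ B}
    (he : ∀ t f, IsometricConj σ B t f → ∀ w, (e w).1 t = f.symm w)
    (he0 : ∀ x, (¬ ∃ f, IsometricConj σ B x f) → ∀ w, (e w).1 x = 0) {h : coindSpace σ B}
    (hh : ∀ x, h.1 x ≠ 0 → ∃ f, IsometricConj σ B x f) : h = e (h.1 1) := by
  ext x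
  by_cases hx : ∃ f, IsometricConj σ B x f
  · obtain ⟨f, hf⟩ := hx
    rw [he _ _ hf, LinearEquiv.eq_symm_apply]
    simpa using h.2 x f hf 1
  · rw [he0 x hx]
    by_contra h0
    exact hx (hh x h0)

theorem coindRep_coindIncl {e : W →ₗ[F] coindSpace σ B}
    (he : ∀ t f, IsometricConj σ B t f → ∀ w, (e w).1 t = f.symm w)
    (he0 : ∀ x, (¬ ∃ f, IsometricConj σ B x f) → ∀ w, (e w).1 x = 0) {t : G} {f : W ≃ₗ[F] W}
    (hf : IsometricConj σ B t f) (w : W) : coindRep σ B t (e w) = e (f w) := by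
  rw [eq_coindIncl he he0 (h := coindRep σ B t (e w)), coindRep_apply, mul_one,
    he _ _ hf.inv]
  · rfl
  · intro x hx
    rw [coindRep_apply] at hx
    by_contra hx'
    refine hx (he0 _ ?_ w)
    rintro ⟨g, hg⟩
    exact hx' ⟨_, by simpa using hf.mul hg⟩

theorem coindIncl_mem_equivHom (hinv : BilinInvariant σ B) {e : W →ₗ[F] coindSpace σ B}
    (he : ∀ t f, IsometricConj σ B t f → ∀ w, (e w).1 t = f.symm w)
    (he0 : ∀ x, (¬ ∃ f, IsometricConj σ B x f) → ∀ w, (e w).1 x = 0) :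
    e ∈ EquivHom σ ((coindRep σ B).comp N.subtype) := fun n w => by
  obtain ⟨f, hf, hfσ⟩ := IsometricConj.exists_coe hinv n
  rw [← hfσ, ← coindRep_coindIncl he he0 hf]
  rfl

theorem coindRep_isIrred [Finite G] [CharP F 2] [PerfectField F] [FiniteDimensional F W]
    (hirr : IsIrred σ)
    (hschur : ∀ f ∈ EquivHom σ σ, ∃ c : F, f = c • (LinearMap.id : W →ₗ[F] W))
    (hB : Nondeg B) (hinv : BilinInvariant σ B) : IsIrred (coindRep σ B) := by
  obtain ⟨e, he, he0⟩ := exists_coindIncl hirr hschur hB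
  have he1 : ∀ w, (e w).1 1 = w := fun w => he _ _ IsometricConj.one w
  have hW := hirr.1
  have heinj : Function.Injective e := fun w w' h => by rw [← he1 w, h, he1]
  refine ⟨heinj.nontrivial, fun U hU => or_iff_not_imp_left.2 fun hU0 => ?_⟩
  -- a nonzero element of minimal support, translated so that it does not vanish at `1`
  obtain ⟨h, ⟨hhU, hh1⟩, hmin⟩ : ∃ h : coindSpace σ B, (h ∈ U ∧ h.1 1 ≠ 0) ∧
      ∀ k ∈ U, k ≠ 0 → (Function.support h.1).ncard ≤ (Function.support k.1).ncard := by
    obtain ⟨h₀, hh₀, hne⟩ := U.ne_bot_iff.1 hU0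
    obtain ⟨h, ⟨hhU, hh0⟩, hmin⟩ := exists_minimalFor_of_wellFoundedLT
      (fun k : coindSpace σ B => k ∈ U ∧ k ≠ 0) (fun k => (Function.support k.1).ncard)
      ⟨h₀, hh₀, hne⟩
    obtain ⟨x, hx⟩ : ∃ x, h.1 x ≠ 0 := by
      by_contra! hx
      exact hh0 (Subtype.ext (funext hx))
    refine ⟨coindRep σ B x⁻¹ h, ⟨hU _ _ hhU, by simpa [coindRep_apply] using hx⟩,
      fun k hk hk0 => ?_⟩
    have : (Function.support (coindRep σ B x⁻¹ h).1) = (x * ·) ⁻¹' Function.support h.1 := by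
      ext y
      simp [coindRep_apply]
    rw [this, Set.ncard_preimage_of_injective_subset_range (mul_right_injective x)
      fun y _ => ⟨x⁻¹ * y, by simp⟩]
    rcases le_total (Function.support h.1).ncard (Function.support k.1).ncard with hle | hle
    · exact hle
    · exact hmin ⟨hk, hk0⟩ hle
  let S : Submodule F (coindSpace σ B) :=
    { carrier := {k | k ∈ U ∧ ∀ x, h.1 x = 0 → k.1 x = 0}
      add_mem' := fun ha hb => ⟨U.add_mem ha.1 hb.1, fun x hx => by simp [ha.2 x hx, hb.2 x hx]⟩
      zero_mem' := ⟨U.zero_mem, fun x _ => rfl⟩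
      smul_mem' := fun c k hk => ⟨U.smul_mem c hk.1, fun x hx => by simp [hk.2 x hx]⟩ }
  have hSN : ∀ (n : N), ∀ k ∈ S, coindRep σ B n k ∈ S := fun n k hk =>
    ⟨hU _ _ hk.1, fun x hx => by rw [coindRep_coe_apply hinv, hk.2 x hx, map_zero]⟩
  let ev : S →ₗ[F] W := LinearMap.proj 1 ∘ₗ (coindSpace σ B).subtype ∘ₗ S.subtype
  have hev : ∀ k : S, ev k = k.1.1 1 := fun k => rfl
  have hevinj : Function.Injective ev := by
    rw [injective_iff_map_eq_zero]
    intro k hk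
    by_contra hk0
    refine absurd (hmin k.1 k.2.1 fun h => hk0 (Subtype.ext h)) (not_le.2 ?_)
    refine Set.ncard_lt_ncard ⟨fun x hx hx' => hx (k.2.2 x hx'), fun hss => ?_⟩ (Set.toFinite _)
    exact hss (a := 1) hh1 hk
  have hevsurj : Function.Surjective ev := by
    rw [← LinearMap.range_eq_top]
    refine (hirr.2 _ ?_).resolve_left fun hbot => hh1 ?_
    · rintro n _ ⟨k, rfl⟩
      refine ⟨⟨_, hSN n k.1 k.2⟩, ?_⟩
      rw [hev, hev, coindRep_coe_apply hinv]
      simp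
    · rw [LinearMap.range_eq_bot] at hbot
      rw [← hev ⟨h, hhU, fun x hx => hx⟩, hbot, LinearMap.zero_apply]
  let E : S ≃ₗ[F] W := LinearEquiv.ofBijective ev ⟨hevinj, hevsurj⟩
  have hE : ∀ k : S, E k = k.1.1 1 := fun k => rfl
  have hEσ : S.subtype ∘ₗ E.symm.toLinearMap ∈
      EquivHom σ ((coindRep σ B).comp N.subtype) := fun n w => by
    have : E.symm (σ n w) = ⟨_, hSN n _ (E.symm w).2⟩ := by
      rw [LinearEquiv.symm_apply_eq, hE]
      dsimp only
      rw [coindRep_coe_apply hinv, ← hE]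
      simp
    simp only [LinearMap.comp_apply, LinearEquiv.coe_coe, this]
    rfl
  have hsupp : h = e (h.1 1) := eq_coindIncl he he0 fun x hx =>
    exists_isometricConj_of_eval_ne_zero hirr hschur hB hinv hEσ
      (w := E ⟨h, hhU, fun x hx => hx⟩) (by simpa using hx)
  have heU : ∀ w, e w ∈ U := by
    have : U.comap e = ⊤ := by
      refine (hirr.2 _ fun n w hw => ?_).resolve_left fun hbot => hh1 ?_
      · rw [Submodule.mem_comap] at hw ⊢
        rw [coindIncl_mem_equivHom hinv he he0 n w]
        exact hU _ _ hw
      · have hmem : h.1 1 ∈ U.comap e := by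
          rw [Submodule.mem_comap, ← hsupp]
          exact hhU
        simpa [hbot] using hmem
    intro w
    have hw : w ∈ U.comap e := this ▸ Submodule.mem_top
    exact hw
  rw [eq_top_iff]
  suffices ∀ (n : ℕ) (k : coindSpace σ B), (Function.support k.1).ncard = n → k ∈ U from
    fun k _ => this _ k rfl
  intro n
  induction n using Nat.strong_induction_on with
  | _ n ih =>
  intro k hk
  by_cases hk0 : k = 0
  · rw [hk0]; exact U.zero_mem
  obtain ⟨x, hx⟩ : ∃ x, k.1 x ≠ 0 := by
    by_contra! hx
    exact hk0 (Subtype.ext (funext hx))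
  have hmemU : coindRep σ B x (e (k.1 x)) ∈ U := hU _ _ (heU _)
  have hval : ∀ y, (k - coindRep σ B x (e (k.1 x))).1 y = k.1 y - (e (k.1 x)).1 (x⁻¹ * y) :=
    fun y => rfl
  rw [← sub_add_cancel k (coindRep σ B x (e (k.1 x)))]
  refine U.add_mem (ih _ ?_ _ rfl) hmemU
  rw [← hk]
  refine Set.ncard_lt_ncard ⟨fun y hy hy0 => hy ?_, fun hss => hss (a := x) hx ?_⟩
    (Set.toFinite _)
  · rw [hval]
    by_cases hxy : ∃ f, IsometricConj σ B (x⁻¹ * y) f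
    · obtain ⟨f, hf⟩ := hxy
      have := k.2 _ f hf x
      rw [mul_inv_cancel_left] at this
      rw [he _ _ hf, ← this]
      simp
    · rw [he0 _ hxy, sub_zero, hy0]
  · rw [hval, inv_mul_cancel, he1, sub_self]

theorem repMult_coindRep [CharP F 2] [PerfectField F] [FiniteDimensional F W]
    (hirr : IsIrred σ)
    (hschur : ∀ f ∈ EquivHom σ σ, ∃ c : F, f = c • (LinearMap.id : W →ₗ[F] W))
    (hB : Nondeg B) (hinv : BilinInvariant σ B) :
    repMult σ ((coindRep σ B).comp N.subtype) = 1 := by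
  obtain ⟨e, he, he0⟩ := exists_coindIncl hirr hschur hB
  have he1 : ∀ w, (e w).1 1 = w := fun w => he _ _ IsometricConj.one w
  have hW := hirr.1
  refine repMult_eq_one (coindIncl_mem_equivHom hinv he he0) (fun h => ?_) fun a ha => ?_
  · obtain ⟨w, hw⟩ := exists_ne (0 : W)
    refine hw ?_
    rw [← he1 w, h]
    rfl
  · obtain ⟨c, hc⟩ := hschur (LinearMap.proj 1 ∘ₗ (coindSpace σ B).subtype ∘ₗ a) fun n w => by
      simp only [LinearMap.comp_apply, ha n w]
      have := coindRep_coe_apply hinv n (a w) 1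
      simpa using this
    refine ⟨c, LinearMap.ext fun w => ?_⟩
    have h1 : (a w).1 1 = c • w := congrArg (fun k : W →ₗ[F] W => k w) hc
    change c • e w = a w
    rw [← map_smul, ← h1]
    exact (eq_coindIncl he he0 fun x hx =>
      exists_isometricConj_of_eval_ne_zero hirr hschur hB hinv ha hx).symm

/-- Frobenius reciprocity: a nonzero map to the canonical extension of `σ`, equivariant under the
inertia group, yields a nonzero map to the coinduced representation. -/
theorem exists_equivHom_coindRep {V : Type} [AddCommGroup V] [Module F V]
    (ρ : Representation F G V) {p : V →ₗ[F] W} (hp0 : p ≠ 0)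
    (hp : ∀ t f, IsometricConj σ B t f → ∀ v, p (ρ t v) = f (p v)) :
    ∃ q ∈ EquivHom ρ (coindRep σ B), q ≠ 0 := by
  refine ⟨LinearMap.codRestrict _ (LinearMap.pi fun x => p ∘ₗ ρ x⁻¹) fun v t f hf x => ?_,
    fun g v => ?_, fun h => hp0 ?_⟩
  · change f (p (ρ (x * t)⁻¹ v)) = p (ρ x⁻¹ v)
    rw [← hp _ _ hf, ← Module.End.mul_apply, ← map_mul]
    simp
  · ext x
    change p (ρ x⁻¹ (ρ g v)) = p (ρ (g⁻¹ * x)⁻¹ v)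
    rw [← Module.End.mul_apply, ← map_mul]
    simp
  · ext v
    have h1 : p (ρ 1⁻¹ v) = 0 := congrArg (fun k : V →ₗ[F] coindSpace σ B => (k v).1 1) h
    simpa using h1

theorem coindRep_isSelfDual [Finite G] [CharP F 2] [PerfectField F] [FiniteDimensional F W]
    (hirr : IsIrred σ)
    (hschur : ∀ f ∈ EquivHom σ σ, ∃ c : F, f = c • (LinearMap.id : W →ₗ[F] W))
    (hB : Nondeg B) (hinv : BilinInvariant σ B) : IsSelfDual (coindRep σ B) := by
  obtain ⟨e, he, he0⟩ := exists_coindIncl hirr hschur hB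
  have he1 : ∀ w, (e w).1 1 = w := fun w => he _ _ IsometricConj.one w
  have heinj : Function.Injective e := fun w w' h => by rw [← he1 w, h, he1]
  have hW := hirr.1
  obtain ⟨b, hb⟩ := exists_equiv_of_nondeg hB
  obtain ⟨q, hq, hq0⟩ := exists_equivHom_coindRep (σ := σ) (B := B) (coindRep σ B).dual
    (p := b.symm.toLinearMap ∘ₗ e.dualMap) (fun h => by
      have hsurj : Function.Surjective (b.symm.toLinearMap ∘ₗ e.dualMap) :=
        b.symm.surjective.comp (LinearMap.dualMap_surjective_of_injective heinj)
      obtain ⟨w, hw⟩ := exists_ne (0 : W)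
      obtain ⟨ξ, hξ⟩ := hsurj w
      rw [h] at hξ
      exact hw hξ.symm) fun t f hf ξ => by
    apply b.injective
    ext w
    have hadj : ∀ v, B (f v) w = B v (f.symm w) := fun v => by
      rw [← hf.2 v (f.symm w), f.apply_symm_apply]
    rw [hb (f _), hadj, ← hb]
    simp only [LinearMap.comp_apply, LinearEquiv.coe_coe, b.apply_symm_apply,
      LinearMap.dualMap_apply, Representation.dual_apply, Module.Dual.transpose_apply]
    rw [coindRep_coindIncl he he0 hf.inv]
  have hsurj := surjective_of_irred (coindRep_isIrred hirr hschur hB hinv) hq hq0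
  have hbij : Function.Bijective q :=
    ⟨(LinearMap.injective_iff_surjective_of_finrank_eq_finrank Subspace.dual_finrank_eq).2 hsurj,
      hsurj⟩
  let Q := LinearEquiv.ofBijective q hbij
  have hQ : ∀ v, Q v = q v := fun v => rfl
  refine ⟨Q.symm, fun g v => ?_⟩
  rw [LinearEquiv.symm_apply_eq, hQ, hq, ← hQ, Q.apply_symm_apply]

end Coinduced

/-- On an odd-dimensional space over a perfect field of characteristic two, every nondegenerate
symmetric form has a nonzero vector representing the additive map `x ↦ √(β x x)`. -/
theorem exists_represents_sqrt {F : Type} [Field F] [CharP F 2] [PerfectField F]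
    {M : Type} [AddCommGroup M] [Module F M]
    (hodd : Odd (finrank F M)) {β : M →ₗ[F] M →ₗ[F] F} (hβ : Nondeg β)
    (hsymm : ∀ x y, β x y = β y x) : ∃ u : M, u ≠ 0 ∧ ∀ x, β u x ^ 2 = β x x := by
  have : FiniteDimensional F M := FiniteDimensional.of_finrank_pos hodd.pos
  choose r hr using fun x : M => exists_sq_eq_of_perfect (β x x)
  let l : M →ₗ[F] F :=
    { toFun := r
      map_add' := fun x y => sq_injective_of_charP_two <| by
        beta_reduce
        have h2 : (2 : F) = 0 := CharTwo.two_eq_zero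
        simp only [hr, map_add, LinearMap.add_apply, hsymm y x]
        linear_combination (β x y - r x * r y) * h2 - hr x - hr y
      map_smul' := fun c x => sq_injective_of_charP_two <| by
        beta_reduce
        simp only [hr, map_smul, LinearMap.smul_apply, smul_eq_mul, RingHom.id_apply, mul_pow]
        ring }
  obtain ⟨b, hb⟩ := exists_equiv_of_nondeg hβ
  have hu : ∀ x, β (b.symm l) x ^ 2 = β x x := fun x => by
    rw [← hb, b.apply_symm_apply]
    exact hr x
  refine ⟨b.symm l, fun h0 => ?_, hu⟩
  refine Nat.not_even_iff_odd.2 hodd (even_finrank_of_isAltForm _ β hβ (fun x => ?_) rfl)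
  rw [← hu, h0]
  simp

/-- A nonzero map out of an irreducible representation is nonzero on some translate of the image
of any nonzero map `f`. -/
theorem exists_translate_ne_zero {F : Type} [Field F] {G : Type} [Group G] {W : Type}
    [AddCommGroup W] [Module F W] {V : Type} [AddCommGroup V] [Module F V]
    {ρ : Representation F G V} (hρ : IsIrred ρ) {W' : Type} [AddCommGroup W'] [Module F W']
    {p : V →ₗ[F] W'} (hp : p ≠ 0) {f : W →ₗ[F] V} (hf : f ≠ 0) :
    ∃ g : G, p ∘ₗ ρ g ∘ₗ f ≠ 0 := by
  by_contra! h
  let U : Submodule F V := ⨅ g : G, LinearMap.ker (p ∘ₗ ρ g)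
  have hmem : ∀ v, v ∈ U ↔ ∀ g, p (ρ g v) = 0 := fun v => by simp [U]
  have hU : IsSubrep ρ U := fun g v hv => by
    rw [hmem] at hv ⊢
    intro x
    rw [← Module.End.mul_apply, ← map_mul]
    exact hv _
  have hfU : ∀ w, f w ∈ U := fun w => (hmem _).2 fun g =>
    congrArg (fun k : W →ₗ[F] W' => k w) (h g)
  rcases hρ.2 U hU with hbot | htop
  · refine hf (LinearMap.ext fun w => ?_)
    simpa [hbot] using hfU w
  · refine hp (LinearMap.ext fun v => ?_)
    have hv : v ∈ U := htop ▸ Submodule.mem_top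
    simpa using (hmem v).1 hv 1

/-- In an irreducible representation of `G`, a nonzero map to an irreducible `N`-module that
occurs in the restriction splits. -/
theorem exists_section {F : Type} [Field F] {G : Type} [Group G] {N : Subgroup G} [N.Normal]
    {W : Type} [AddCommGroup W] [Module F W] [FiniteDimensional F W]
    {σ : Representation F ↥N W} {V : Type} [AddCommGroup V] [Module F V]
    {ρ : Representation F G V} (hρ : IsIrred ρ) (hirr : IsIrred σ) {p : V →ₗ[F] W}
    (hp0 : p ≠ 0) (hp : p ∈ EquivHom (ρ.comp N.subtype) σ) {f : W →ₗ[F] V} (hf0 : f ≠ 0)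
    (hf : f ∈ EquivHom σ (ρ.comp N.subtype)) :
    ∃ s ∈ EquivHom σ (ρ.comp N.subtype), ∀ w, p (s w) = w := by
  obtain ⟨g, hg⟩ := exists_translate_ne_zero hρ hp0 hf0
  have hρf : ∀ (n : N) w, ρ g (f (σ n w)) = ρ (MulAut.conjNormal g n : N) (ρ g (f w)) :=
    fun n w => by
      rw [hf n w, ← Module.End.mul_apply]
      change ρ g (ρ n (f w)) = _
      rw [← Module.End.mul_apply, ← Module.End.mul_apply, ← map_mul, ← map_mul]
      simp
  let a : W →ₗ[F] W := p ∘ₗ ρ g ∘ₗ f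
  have ha : ∀ (n : N) w, a (σ n w) = σ (MulAut.conjNormal g n) (a w) := fun n w => by
    simp only [a, LinearMap.comp_apply, hρf]
    exact hp (MulAut.conjNormal g n) (ρ g (f w))
  have hinj : Function.Injective a :=
    injective_of_irred hirr (fun n => σ (MulAut.conjNormal g n)) ha hg
  let E : W ≃ₗ[F] W := LinearEquiv.ofInjectiveEndo a hinj
  have hE : ∀ w, E w = a w := fun w => rfl
  refine ⟨ρ g ∘ₗ f ∘ₗ E.symm.toLinearMap, fun n w => ?_, fun w => ?_⟩
  · have : E.symm (σ n w) = σ (MulAut.conjNormal g⁻¹ n) (E.symm w) := by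
      rw [LinearEquiv.symm_apply_eq, hE, ha, ← hE, E.apply_symm_apply, ← MulAut.mul_apply,
        ← map_mul]
      simp
    simp only [LinearMap.comp_apply, LinearEquiv.coe_coe, this, hρf, ← MulAut.mul_apply,
      ← map_mul]
    simp
  · exact E.apply_symm_apply w

/-- A self-dual irreducible representation containing `σ` with odd multiplicity is the coinduced
representation. -/
theorem repIso_coindRep {F : Type} [Field F] [CharP F 2] [PerfectField F]
    {G : Type} [Group G] [Finite G] {N : Subgroup G} [N.Normal]
    {W : Type} [AddCommGroup W] [Module F W] [FiniteDimensional F W]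
    {σ : Representation F ↥N W} {B : W →ₗ[F] W →ₗ[F] F} (hirr : IsIrred σ)
    (hschur : ∀ f ∈ EquivHom σ σ, ∃ c : F, f = c • (LinearMap.id : W →ₗ[F] W))
    (hB : Nondeg B) (hinv : BilinInvariant σ B) (hsymm : ∀ v w, B v w = B w v)
    {V : Type} [AddCommGroup V] [Module F V] {ρ : Representation F G V} (hρ : IsIrred ρ)
    (hsd : IsSelfDual ρ) (hodd : Odd (repMult σ (ρ.comp N.subtype))) :
    RepIso ρ (coindRep σ B) := by
  obtain ⟨D, hDinv, hD, hDsymm⟩ := exists_symm_invariant_form ρ hρ hsd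
  have := hirr.1
  obtain ⟨w₀, hw₀⟩ := exists_ne (0 : W)
  obtain ⟨w₁, hw₁⟩ : ∃ w₁, B w₀ w₁ = 1 := by
    obtain ⟨w, hw⟩ : ∃ w, B w₀ w ≠ 0 := by
      by_contra! h
      exact hw₀ (hB w₀ h)
    exact ⟨(B w₀ w)⁻¹ • w, by simp [hw]⟩
  let M := EquivHom σ (ρ.comp N.subtype)
  let ev : W → M →ₗ[F] V := fun w => LinearMap.applyₗ w ∘ₗ M.subtype
  let β : M →ₗ[F] M →ₗ[F] F := D.compl₁₂ (ev w₀) (ev w₁)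
  have hβ : ∀ (f f' : M) w w', D (f.1 w) (f'.1 w') = β f f' * B w w' := fun f f' => by
    obtain ⟨c, hc⟩ := form_eq_smul (C := D.compl₁₂ f.1 f'.1) hschur hB hinv fun n v w => by
      simp only [LinearMap.compl₁₂_apply, f.2 n v, f'.2 n w]
      exact hDinv _ _ _
    have hβc : β f f' = c := by
      have := hc w₀ w₁
      rwa [hw₁, mul_one] at this
    intro w w'
    rw [hβc]
    exact hc w w'
  have hβsymm : ∀ f f', β f f' = β f' f := fun f f' => by
    have h1 := hβ f f' w₁ w₀
    rw [hDsymm, hsymm w₁, hw₁, mul_one] at h1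
    rw [← h1]
    rfl
  obtain ⟨b, hb⟩ := exists_equiv_of_nondeg hB
  -- the adjoint of `f : W → V` with respect to `B` and `D`
  let adj : (W →ₗ[F] V) → V →ₗ[F] W := fun f => b.symm.toLinearMap ∘ₗ f.dualMap ∘ₗ D
  have hadj : ∀ f v w, B (adj f v) w = D v (f w) := fun f v w => by
    rw [← hb]
    simp [adj]
  have hBext : ∀ v v', (∀ w, B v w = B v' w) → v = v' := fun v v' h =>
    b.injective (LinearMap.ext fun w => by rw [hb, hb, h])
  have hadj0 : ∀ f, f ≠ 0 → adj f ≠ 0 := fun f hf h => by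
    refine hf (LinearMap.ext fun w => hD _ fun v => ?_)
    rw [hDsymm, ← hadj, h]
    simp
  have hadjEq : ∀ f (t : G) (k : W ≃ₗ[F] W), (∀ w w', B (k w) (k w') = B w w') →
      (∀ w, f (k w) = ρ t (f w)) → ∀ v, adj f (ρ t v) = k (adj f v) :=
    fun f t k hk hf v => hBext _ _ fun w => by
      have h1 := hk (adj f v) (k.symm w)
      have h2 := hf (k.symm w)
      rw [k.apply_symm_apply] at h1 h2
      rw [hadj, h1, hadj, h2, hDinv]
  have hβnd : Nondeg β := fun f hf => by
    by_contra hf0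
    have hf0' : f.1 ≠ 0 := fun h => hf0 (Subtype.ext h)
    have hadjN : adj f.1 ∈ EquivHom (ρ.comp N.subtype) σ := fun n v => by
      obtain ⟨k, hk, hkσ⟩ := IsometricConj.exists_coe hinv n
      rw [← hkσ]
      exact hadjEq f.1 n k hk.2 (fun w => by rw [hkσ]; exact f.2 n w) v
    obtain ⟨s, hs, hps⟩ := exists_section hρ hirr (hadj0 _ hf0') hadjN hf0' f.2
    have h1 := hadj f.1 (s w₀) w₁
    rw [hps, hw₁, hDsymm, hβ f ⟨s, hs⟩, hf, zero_mul] at h1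
    exact one_ne_zero h1
  obtain ⟨u, hu0, hu⟩ := exists_represents_sqrt hodd hβnd hβsymm
  -- the inertia group acts on the multiplicity space by isometries of `β`
  have hact : ∀ t k, IsometricConj σ B t k → ∀ f : M, ∃ f' : M, ∀ w, f'.1 (k w) = ρ t (f.1 w) :=
    fun t k hk f => by
      refine ⟨⟨ρ t ∘ₗ f.1 ∘ₗ k.symm.toLinearMap, fun n w => ?_⟩, fun w => by simp⟩
      simp only [LinearMap.comp_apply, LinearEquiv.coe_coe, hk.inv.1, f.2 _ (k.symm w)]
      change ρ t (ρ _ _) = ρ n (ρ t _)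
      rw [← Module.End.mul_apply, ← Module.End.mul_apply, ← map_mul, ← map_mul]
      congr 2
      simp [mul_assoc]
  have hactβ : ∀ t k, IsometricConj σ B t k → ∀ f f' g g' : M,
      (∀ w, f'.1 (k w) = ρ t (f.1 w)) → (∀ w, g'.1 (k w) = ρ t (g.1 w)) → β f' g' = β f g :=
    fun t k hk f f' g g' hf hg => by
      have h1 := hβ f' g' (k w₀) (k w₁)
      rw [hf, hg, hDinv, hβ, hk.2, hw₁, mul_one, mul_one] at h1
      exact h1.symm
  have hufix : ∀ t k, IsometricConj σ B t k → ∀ w, u.1 (k w) = ρ t (u.1 w) := fun t k hk => by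
    obtain ⟨u', hu'⟩ := hact t k hk u
    have huu : u' = u := by
      rw [← sub_eq_zero]
      refine hβnd _ fun g => ?_
      obtain ⟨g', hg'⟩ := hact _ _ hk.inv g
      have hg : ∀ w, g.1 (k w) = ρ t (g'.1 w) := fun w => by
        have := hg' (k w)
        rw [LinearEquiv.symm_apply_apply] at this
        rw [this, ← Module.End.mul_apply, ← map_mul]
        simp
      rw [map_sub, LinearMap.sub_apply, hactβ t k hk u u' g' g hu' hg, sub_eq_zero]
      refine sq_injective_of_charP_two ?_
      beta_reduce
      rw [hu, hu]
      exact (hactβ t k hk g' g g' g hg hg).symm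
    rwa [huu] at hu'
  obtain ⟨q, hq, hq0⟩ := exists_equivHom_coindRep ρ (hadj0 u.1 fun h => hu0 (Subtype.ext h))
    fun t k hk => hadjEq u.1 t k hk.2 (hufix t k hk)
  exact ⟨LinearEquiv.ofBijective q ⟨injective_of_irred hρ (coindRep σ B) hq hq0,
    surjective_of_irred (coindRep_isIrred hirr hschur hB hinv) hq hq0⟩, hq⟩

/-- a self-dual irreducible FN-module W occurs with odd multiplicity in the
restriction of exactly one self-dual irreducible FG-module V (up to isomorphism), and there
the multiplicity is 1. -/
theorem stmt_11 {F : Type} [Field F] [CharP F 2] [PerfectField F]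
    {G : Type} [Group G] [Finite G] (N : Subgroup G) [N.Normal]
    (hsplit : ∀ H : Subgroup G, IsSplitting F ↥H)
    {W : Type} [AddCommGroup W] [Module F W] [FiniteDimensional F W]
    (σ : Representation F ↥N W) (hirr : IsIrred σ) (hsd : IsSelfDual σ) :
    (∃ M : RepOn F G, (FiniteDimensional F M.carrier ∧ IsIrred M.rep ∧ IsSelfDual M.rep ∧
        Odd (repMult σ (M.rep.comp N.subtype))) ∧
        repMult σ (M.rep.comp N.subtype) = 1) ∧
    (∀ M₁ M₂ : RepOn F G,
      (FiniteDimensional F M₁.carrier ∧ IsIrred M₁.rep ∧ IsSelfDual M₁.rep ∧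
        Odd (repMult σ (M₁.rep.comp N.subtype))) →
      (FiniteDimensional F M₂.carrier ∧ IsIrred M₂.rep ∧ IsSelfDual M₂.rep ∧
        Odd (repMult σ (M₂.rep.comp N.subtype))) →
      RepIso M₁.rep M₂.rep) := by
  have hschur := hsplit N W σ inferInstance hirr
  obtain ⟨B, hinv, hB, hsymm⟩ := exists_symm_invariant_form σ hirr hsd
  have hmult := repMult_coindRep hirr hschur hB hinv
  refine ⟨⟨⟨coindSpace σ B, coindRep σ B⟩, ⟨?_, coindRep_isIrred hirr hschur hB hinv,
    coindRep_isSelfDual hirr hschur hB hinv, ?_⟩, hmult⟩, ?_⟩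
  · exact inferInstanceAs (FiniteDimensional F (coindSpace σ B))
  · exact hmult ▸ odd_one
  · rintro M₁ M₂ ⟨-, h₁, hsd₁, hodd₁⟩ ⟨-, h₂, hsd₂, hodd₂⟩
    obtain ⟨e₁, he₁⟩ := repIso_coindRep hirr hschur hB hinv hsymm h₁ hsd₁ hodd₁
    obtain ⟨e₂, he₂⟩ := repIso_coindRep hirr hschur hB hinv hsymm h₂ hsd₂ hodd₂
    refine ⟨e₁.trans e₂.symm, fun g v => ?_⟩
    rw [LinearEquiv.trans_apply, LinearEquiv.symm_apply_eq, he₁, he₂]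
    simp
end
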